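/- arXiv:2305.16574 — 2 statements merged into one kernel-verified Lean document; each statement's English description precedes it below -/
import Mathlib

section
/- For every cyclic system b of rank n ≥ 2, the contextual fraction equals (n − 1) times the quasi-coupling measure of contextuality: CNTF(b) = (n − 1) · CNT3(b). -/
open Finset

/-- Cyclic predecessor `i ⊖ 1` on `Fin n`. -/
def fpred {n : ℕ} (i : Fin n) : Fin n := ⟨(i.val + (n - 1)) % n, Nat.mod_lt _ i.pos⟩

/-- Cyclic successor `i ⊕ 1` on `Fin n`. -/
def fsucc {n : ℕ} (i : Fin n) : Fin n := ⟨(i.val + 1) % n, Nat.mod_lt _ i.pos⟩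

/-- `b` specifies a cyclic system of rank `n`: each bunch distribution is
nonnegative and sums to one. -/
def IsCyclicSystem (n : ℕ) (b : Fin n → Bool → Bool → ℝ) : Prop :=
  (∀ i r r', 0 ≤ b i r r') ∧ ∀ i, (∑ r : Bool, ∑ r' : Bool, b i r r') = 1

/-- Marginal distribution of `R_i^i`. -/
def mFst {n : ℕ} (b : Fin n → Bool → Bool → ℝ) (i : Fin n) (r : Bool) : ℝ :=
  b i r false + b i r true

/-- Marginal distribution of `R_i^{i⊖1}`. -/
def mSnd {n : ℕ} (b : Fin n → Bool → Bool → ℝ) (i : Fin n) (r : Bool) : ℝ :=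
  b (fpred i) false r + b (fpred i) true r

/-- Multimaximal-coupling distribution of connection `i`:
joint distribution of `(T_i^i, T_i^{i⊖1})`. -/
noncomputable def mmc {n : ℕ} (b : Fin n → Bool → Bool → ℝ) (i : Fin n) : Bool → Bool → ℝ :=
  fun r r' =>
    match r, r' with
    | true, true => min (mFst b i true) (mSnd b i true)
    | false, false => min (mFst b i false) (mSnd b i false)
    | true, false => mFst b i true - min (mFst b i true) (mSnd b i true)
    | false, true => mSnd b i true - min (mFst b i true) (mSnd b i true)

/-- Bunch marginal of a signed quasi-coupling `y` at context `i`. -/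
def Bm {n : ℕ} (i : Fin n) (y : (Fin n → Bool × Bool) → ℝ) (r r' : Bool) : ℝ :=
  ∑ s : Fin n → Bool × Bool, if s i = (r, r') then y s else 0

/-- Connection marginal of a signed quasi-coupling `y` at content `i`. -/
def Cm {n : ℕ} (i : Fin n) (y : (Fin n → Bool × Bool) → ℝ) (r r' : Bool) : ℝ :=
  ∑ s : Fin n → Bool × Bool, if (s i).1 = r ∧ (s (fpred i)).2 = r' then y s else 0

/-- `y` is a feasible signed quasi-coupling for the system `b`. -/
def Feasible {n : ℕ} (b : Fin n → Bool → Bool → ℝ) (y : (Fin n → Bool × Bool) → ℝ) : Prop :=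
  ∀ i r r', Bm i y r r' = b i r r' ∧ Cm i y r r' = mmc b i r r'

/-- The quasi-coupling measure of contextuality. -/
noncomputable def CNT3 {n : ℕ} (b : Fin n → Bool → Bool → ℝ) : ℝ :=
  sInf {t : ℝ | ∃ y, Feasible b y ∧ t = ∑ s : Fin n → Bool × Bool, |y s|} - 1

/-- Constraints of the contextual-fraction linear program. -/
def CNTFConstraints {n : ℕ} (b : Fin n → Bool → Bool → ℝ)
    (z : (Fin n → Bool × Bool) → ℝ) : Prop :=
  (∀ s, 0 ≤ z s) ∧ ∀ i r r', Bm i z r r' ≤ b i r r' ∧ Cm i z r r' ≤ mmc b i r r'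

/-- The contextual fraction. -/
noncomputable def CNTF {n : ℕ} (b : Fin n → Bool → Bool → ℝ) : ℝ :=
  1 - sSup {t : ℝ | ∃ z, CNTFConstraints b z ∧ t = ∑ s : Fin n → Bool × Bool, z s}

/-- `b` is noncontextual iff it admits a nonnegative feasible coupling. -/
def Noncontextual {n : ℕ} (b : Fin n → Bool → Bool → ℝ) : Prop :=
  ∃ y, Feasible b y ∧ ∀ s, 0 ≤ y s

/-- The joint marginal of a signed measure `y` on the edge `(k, k + 1)`, where the state `s` assigns
the value `val s k` to the vertex `k`. -/
def edgeMarginal {S : Type*} [Fintype S] (val : S → ℕ → Bool) (k : ℕ) (y : S → ℝ)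
    (a b : Bool) : ℝ :=
  ∑ s, if val s k = a ∧ val s (k + 1) = b then y s else 0

section EdgeMarginal

variable {S : Type*} [Fintype S] (val : S → ℕ → Bool) (k : ℕ)

lemma sum_mul_edgeMarginal (y : S → ℝ) (c : Bool → Bool → ℝ) :
    ∑ a, ∑ b, c a b * edgeMarginal val k y a b =
      ∑ s, c (val s k) (val s (k + 1)) * y s := by
  simp only [edgeMarginal, Fintype.sum_bool, mul_sum, ← sum_add_distrib]
  refine sum_congr rfl fun s _ => ?_
  cases val s k <;> cases val s (k + 1) <;> simp

lemma sum_edgeMarginal (y : S → ℝ) :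
    ∑ a, ∑ b, edgeMarginal val k y a b = ∑ s, y s := by
  simpa using sum_mul_edgeMarginal val k y fun _ _ => 1

lemma sum_fst_edgeMarginal (y : S → ℝ) (b : Bool) :
    ∑ a, edgeMarginal val k y a b = ∑ c, edgeMarginal val (k + 1) y b c := by
  simp only [edgeMarginal, Fintype.sum_bool, ← sum_add_distrib]
  refine sum_congr rfl fun s _ => ?_
  cases val s k <;> cases val s (k + 1) <;> cases val s (k + 1 + 1) <;> simp

lemma edgeMarginal_add (y z : S → ℝ) (a b : Bool) :
    edgeMarginal val k (y + z) a b = edgeMarginal val k y a b + edgeMarginal val k z a b := by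
  simp only [edgeMarginal, ← sum_add_distrib]
  refine sum_congr rfl fun s _ => ?_
  split_ifs <;> simp

lemma edgeMarginal_smul (c : ℝ) (y : S → ℝ) (a b : Bool) :
    edgeMarginal val k (c • y) a b = c * edgeMarginal val k y a b := by
  simp only [edgeMarginal, mul_sum]
  refine sum_congr rfl fun s _ => ?_
  split_ifs <;> simp

lemma edgeMarginal_sum {ι : Type*} (t : Finset ι) (y : ι → S → ℝ) (a b : Bool) :
    edgeMarginal val k (∑ i ∈ t, y i) a b = ∑ i ∈ t, edgeMarginal val k (y i) a b := by
  simp only [edgeMarginal]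
  rw [sum_comm]
  refine sum_congr rfl fun s _ => ?_
  split_ifs <;> simp

lemma edgeMarginal_single [DecidableEq S] (s : S) (a b : Bool) :
    edgeMarginal val k (Pi.single s 1) a b =
      if val s k = a ∧ val s (k + 1) = b then 1 else 0 := by
  rw [edgeMarginal, sum_eq_single s] <;> simp +contextual

end EdgeMarginal

/-- A consistent family of edge weights on an `N`-cycle admitting no closed walk of positive weight
is a multiple of a Popescu–Rohrlich box, described by a walk `g` reversing its value around the
cycle. -/
lemma exists_twisted_walk {N : ℕ} {ε : ℝ} (hε : 0 < ε) (r : ℕ → Bool → Bool → ℝ)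
    (nonneg : ∀ k < N, ∀ a b, 0 ≤ r k a b)
    (cons : ∀ k b, ∑ a, r k a b = ∑ c, r (k + 1) b c)
    (per : r N = r 0) (total : ∑ a, ∑ b, r 0 a b = ε)
    (noclosed : ∀ f : ℕ → Bool, f N = f 0 → ∃ k < N, r k (f k) (f (k + 1)) ≤ 0) :
    ∃ g : ℕ → Bool, g N = !g 0 ∧ ∀ k < N, ∀ a b,
      r k a b = if (a ^^ g k) = (b ^^ g (k + 1)) then ε / 2 else 0 := by
  have next : ∀ k a, ∃ b, k < N → 0 < ∑ c, r k a c → 0 < r k a b := by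
    intro k a
    by_cases h : 0 < ∑ c, r k a c
    · obtain ⟨b, -, hb⟩ := exists_lt_of_sum_lt (s := univ) (f := fun _ : Bool => (0 : ℝ))
        (by simpa using h)
      exact ⟨b, fun _ _ => hb⟩
    · exact ⟨a, fun _ h' => absurd h' h⟩
  choose nxt hnxt using next
  have walk : ∀ a₀, 0 < ∑ c, r 0 a₀ c →
      ∃ g : ℕ → Bool, g 0 = a₀ ∧ ∀ k < N, 0 < r k (g k) (g (k + 1)) := by
    intro a₀ h₀
    let g : ℕ → Bool := fun k => Nat.rec a₀ nxt k
    have pos : ∀ k ≤ N, 0 < ∑ c, r k (g k) c := by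
      intro k
      induction k with
      | zero => exact fun _ => h₀
      | succ k ih =>
        intro hk
        rw [← cons k]
        exact (hnxt k (g k) hk (ih (by omega))).trans_le
          (single_le_sum (f := fun a => r k a (g (k + 1))) (fun a _ => nonneg k hk a _) (mem_univ _))
    exact ⟨g, rfl, fun k hk => hnxt k (g k) hk (pos k hk.le)⟩
  have splice : ∀ g h : ℕ → Bool, (∀ k < N, 0 < r k (g k) (g (k + 1))) →
      (∀ k < N, 0 < r k (h k) (h (k + 1))) → ∀ k < N, h N = g 0 →
      r k (g k) (h (k + 1)) ≤ 0 := by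
    intro g h hg hh k hk hc
    obtain ⟨i, hi, hle⟩ := noclosed (fun i => if i ≤ k then g i else h i) (by simp [hk, hc])
    rcases lt_trichotomy i k with hik | rfl | hik
    · simp only [hik.le, Nat.succ_le_iff.mpr hik, if_true] at hle
      exact absurd (hg i hi) hle.not_gt
    · simpa using hle
    · simp only [hik.not_ge, (show ¬ i + 1 ≤ k by omega), if_false] at hle
      exact absurd (hh i hi) hle.not_gt
  have reverse : ∀ g : ℕ → Bool, (∀ k < N, 0 < r k (g k) (g (k + 1))) → g N = !g 0 := by
    intro g hg
    by_contra hne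
    obtain ⟨i, hi, hle⟩ := noclosed g (by cases h₁ : g N <;> cases h₂ : g 0 <;> simp_all)
    exact absurd (hg i hi) hle.not_gt
  obtain ⟨a₀, -, ha₀⟩ := exists_lt_of_sum_lt (s := univ) (f := fun _ : Bool => (0 : ℝ))
    (g := fun a => ∑ b, r 0 a b) (by rw [total]; simpa using hε)
  obtain ⟨g, -, hg⟩ := walk a₀ ha₀
  have gN := reverse g hg
  have hN : 0 < N := by
    rcases Nat.eq_zero_or_pos N with rfl | h
    · cases h : g 0 <;> simp [h] at gN
    · exact h
  obtain ⟨M, rfl⟩ : ∃ M, N = M + 1 := ⟨N - 1, by omega⟩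
  obtain ⟨h, h0, hh⟩ := walk (!g 0) (by
    rw [← per, ← gN, ← cons]
    exact (hg M (by omega)).trans_le
      (single_le_sum (f := fun a => r M a (g (M + 1))) (fun a _ => nonneg M (by omega) a _)
        (mem_univ _)))
  have hN' := reverse h hh
  rw [h0, Bool.not_not] at hN'
  have hcompl : ∀ k ≤ M + 1, h k = !g k := by
    intro k hk
    rcases hk.lt_or_eq with hk | rfl
    · by_contra hne
      have heq : h k = g k := by cases h₁ : h k <;> cases h₂ : g k <;> simp_all
      have := splice h g hh hg k hk (by rw [gN, h0])
      rw [heq] at this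
      exact absurd (hg k hk) this.not_gt
    · rw [hN', gN, Bool.not_not]
  have cross₁ : ∀ k < M + 1, r k (g k) (!g (k + 1)) = 0 := fun k hk => by
    refine le_antisymm ?_ (nonneg k hk _ _)
    rw [← hcompl (k + 1) hk]
    exact splice g h hg hh k hk hN'
  have cross₂ : ∀ k < M + 1, r k (!g k) (g (k + 1)) = 0 := fun k hk => by
    refine le_antisymm ?_ (nonneg k hk _ _)
    rw [← hcompl k hk.le]
    exact splice h g hh hg k hk (by rw [gN, h0])
  have sum_bool' : ∀ (c : Bool) (f : Bool → ℝ), ∑ a, f a = f c + f (!c) := by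
    intro c f
    cases c <;> simp [add_comm]
  have out₁ : ∀ k < M + 1, ∑ c, r k (g k) c = r k (g k) (g (k + 1)) := fun k hk => by
    rw [sum_bool' (g (k + 1)), cross₁ k hk, add_zero]
  have out₂ : ∀ k < M + 1, ∑ c, r k (!g k) c = r k (!g k) (!g (k + 1)) := fun k hk => by
    rw [sum_bool' (g (k + 1)), cross₂ k hk, zero_add]
  have straight : ∀ k ≤ M + 1, ∑ c, r k (g k) c = ∑ c, r 0 (g 0) c ∧
      ∑ c, r k (!g k) c = ∑ c, r 0 (!g 0) c := by
    intro k
    induction k with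
    | zero => simp
    | succ k ih =>
      intro hk
      obtain ⟨ih₁, ih₂⟩ := ih (by omega)
      rw [← cons, ← cons, ← ih₁, ← ih₂, out₁ k hk, out₂ k hk, sum_bool' (g k),
        sum_bool' (g k) fun a => r k a (!g (k + 1)), cross₁ k hk, cross₂ k hk]
      simp
  have hhalf := (straight (M + 1) le_rfl).1
  rw [per, gN] at hhalf
  rw [sum_bool' (g 0)] at total
  refine ⟨g, gN, fun k hk a b => ?_⟩
  obtain ⟨s₁, s₂⟩ := straight k hk.le
  rw [out₁ k hk] at s₁
  rw [out₂ k hk] at s₂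
  have e₁ : r k (g k) (g (k + 1)) = ε / 2 := by linarith
  have e₂ : r k (!g k) (!g (k + 1)) = ε / 2 := by linarith
  have c₁ := cross₁ k hk
  have c₂ := cross₂ k hk
  clear * - e₁ e₂ c₁ c₂
  cases h₁ : g k <;> cases h₂ : g (k + 1) <;> cases a <;> cases b <;> simp_all

/-- The walk following `g` twisted by `a`, then reversed after step `j`. -/
def defectWalk (g : ℕ → Bool) (j : ℕ) (a : Bool) (k : ℕ) : Bool :=
  if k ≤ j then a ^^ g k else !(a ^^ g k)

lemma defectWalk_closed {N j : ℕ} {g : ℕ → Bool} (hg : g N = !g 0) (hj : j < N) (a : Bool) :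
    defectWalk g j a N = defectWalk g j a 0 := by
  simp [defectWalk, hj.not_ge, hg]

lemma xor_defectWalk_eq_iff (g : ℕ → Bool) (j : ℕ) (a : Bool) (k : ℕ) :
    (defectWalk g j a k ^^ g k) = (defectWalk g j a (k + 1) ^^ g (k + 1)) ↔ k ≠ j := by
  rcases lt_trichotomy k j with h | rfl | h
  · simp only [defectWalk, h.le, Nat.succ_le_iff.mpr h, if_true, h.ne, ne_eq, not_false_iff, iff_true]
    cases a <;> cases g k <;> cases g (k + 1) <;> rfl
  · simp only [defectWalk, le_refl, if_true, (show ¬ k + 1 ≤ k by omega), if_false, ne_eq,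
      not_true, iff_false]
    cases a <;> cases g k <;> cases g (k + 1) <;> simp
  · simp only [defectWalk, h.not_ge, (show ¬ k + 1 ≤ j by omega), if_false, h.ne', ne_eq,
      not_false_iff, iff_true]
    cases a <;> cases g k <;> cases g (k + 1) <;> rfl

lemma defectWalk_not (g : ℕ → Bool) (j : ℕ) (a : Bool) (k : ℕ) :
    defectWalk g j (!a) k = !defectWalk g j a k := by
  unfold defectWalk
  split_ifs <;> simp

/-- A walk reversing relative to `g` at some step cannot be in phase with `g` at all of them. -/
lemma exists_out_of_phase {N : ℕ} {g v : ℕ → Bool} (hg : g N = !g 0) (hv : v N = v 0) :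
    ∃ k < N, ¬ (v k ^^ g k) = (v (k + 1) ^^ g (k + 1)) := by
  by_contra! h
  have key : ∀ k ≤ N, (v k ^^ g k) = (v 0 ^^ g 0) := by
    intro k
    induction k with
    | zero => simp
    | succ k ih => exact fun hk => (h k hk).symm.trans (ih (by omega))
  have := key N le_rfl
  rw [hg, hv] at this
  cases h₁ : v 0 <;> cases h₂ : g 0 <;> simp_all

/-- The alternating twist `k ↦ g k ^^ (k odd)`. -/
def alternate (g : ℕ → Bool) (k : ℕ) : Bool := g k ^^ Nat.bodd k

lemma xor_alternate_eq_iff (g : ℕ → Bool) (k : ℕ) (a b : Bool) :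
    (a ^^ alternate g k) = (b ^^ alternate g (k + 1)) ↔ ¬ (a ^^ g k) = (b ^^ g (k + 1)) := by
  simp only [alternate, Nat.bodd_succ]
  cases a <;> cases b <;> cases g k <;> cases g (k + 1) <;> cases Nat.bodd k <;> simp

lemma alternate_twisted {N : ℕ} {g : ℕ → Bool} (hN : Even N) (hg : g N = !g 0) :
    alternate g N = !alternate g 0 := by
  have : Nat.bodd N = false := by
    obtain ⟨m, rfl⟩ := hN
    simp
  simp [alternate, this, hg]

lemma defectWalk_self {g v : ℕ → Bool} {j : ℕ}
    (h : ¬ (v j ^^ g j) = (v (j + 1) ^^ g (j + 1))) :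
    defectWalk g j (v j ^^ g j) j = v j ∧ defectWalk g j (v j ^^ g j) (j + 1) = v (j + 1) := by
  simp only [defectWalk, le_refl, if_true, (show ¬ j + 1 ≤ j by omega), if_false]
  revert h
  cases v j <;> cases g j <;> cases v (j + 1) <;> cases g (j + 1) <;> simp

lemma sum_defectWalk_indicator (g : ℕ → Bool) (j k : ℕ) (a b : Bool) :
    (∑ c, if defectWalk g j c k = a ∧ defectWalk g j c (k + 1) = b then (1 : ℝ) else 0) =
      if ((a ^^ g k) = (b ^^ g (k + 1)) ↔ k ≠ j) then 1 else 0 := by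
  have h := xor_defectWalk_eq_iff g j true k
  have h₁ := defectWalk_not g j true k
  have h₂ := defectWalk_not g j true (k + 1)
  rw [Bool.not_true] at h₁ h₂
  simp only [Fintype.sum_bool, h₁, h₂, ← h]
  clear h h₁ h₂
  cases defectWalk g j true k <;> cases defectWalk g j true (k + 1) <;> cases a <;> cases b <;>
    cases g k <;> cases g (k + 1) <;> simp

lemma sum_range_iff_ne {N k : ℕ} (hk : k < N) (P : Prop) [Decidable P] :
    (∑ j ∈ range N, if (P ↔ k ≠ j) then (1 : ℝ) else 0) = if P then (N : ℝ) - 1 else 1 := by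
  by_cases hP : P
  · have : ∀ j, (if (P ↔ k ≠ j) then (1 : ℝ) else 0) = 1 - if k = j then 1 else 0 := by
      intro j
      by_cases h : k = j <;> simp [hP, h]
    rw [sum_congr rfl fun j _ => this j, sum_sub_distrib]
    simp [hP, hk]
  · simp [hP, hk]

/-- The sign recording whether a pair of values on the edge `(k, k + 1)` is in phase with `g`. -/
noncomputable def phaseSign (g : ℕ → Bool) (k : ℕ) (a b : Bool) : ℝ :=
  if (a ^^ g k) = (b ^^ g (k + 1)) then 1 else -1

lemma sum_phaseSign (g v : ℕ → Bool) (N : ℕ) :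
    ∑ k ∈ range N, phaseSign g k (v k) (v (k + 1)) =
      N - 2 * #{k ∈ range N | ¬ (v k ^^ g k) = (v (k + 1) ^^ g (k + 1))} := by
  have : ∀ k, phaseSign g k (v k) (v (k + 1)) =
      1 - 2 * if ¬ (v k ^^ g k) = (v (k + 1) ^^ g (k + 1)) then 1 else 0 := by
    intro k
    unfold phaseSign
    by_cases h : (v k ^^ g k) = (v (k + 1) ^^ g (k + 1))
    · simp [h]
    · simp only [h, if_false, not_false_iff, if_true]
      norm_num
  simp only [this, sum_sub_distrib, ← mul_sum, sum_boole]
  simp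

/-- The Bell inequality on a single deterministic assignment. -/
lemma abs_sum_phaseSign_le {N : ℕ} (hN : Even N) {g v : ℕ → Bool} (hg : g N = !g 0)
    (hv : v N = v 0) :
    |∑ k ∈ range N, phaseSign g k (v k) (v (k + 1))| ≤ (N : ℝ) - 2 := by
  rw [sum_phaseSign]
  obtain ⟨i, hi, hi'⟩ := exists_out_of_phase hg hv
  obtain ⟨j, hj, hj'⟩ := exists_out_of_phase (alternate_twisted hN hg) hv
  rw [xor_alternate_eq_iff, not_not] at hj'
  have lower : 1 ≤ #{k ∈ range N | ¬ (v k ^^ g k) = (v (k + 1) ^^ g (k + 1))} :=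
    card_pos.mpr ⟨i, by simp [hi, hi']⟩
  have upper : #{k ∈ range N | ¬ (v k ^^ g k) = (v (k + 1) ^^ g (k + 1))} < N := by
    conv_rhs => rw [← card_range N]
    exact card_lt_card (filter_ssubset.mpr ⟨j, mem_range.mpr hj, by simpa using hj'⟩)
  have lower' : (1 : ℝ) ≤ #{k ∈ range N | ¬ (v k ^^ g k) = (v (k + 1) ^^ g (k + 1))} := by
    exact_mod_cast lower
  have upper' : (#{k ∈ range N | ¬ (v k ^^ g k) = (v (k + 1) ^^ g (k + 1))} : ℝ) + 1 ≤ N := by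
    exact_mod_cast upper
  rw [abs_le]
  constructor <;> linarith

section Cycle

variable {S : Type*} [Fintype S] {N : ℕ} {val : S → ℕ → Bool} {mk : (ℕ → Bool) → S}

/-- A Popescu–Rohrlich box is the family of edge marginals of a signed measure of total variation
at most `N / (N - 2)`. -/
lemma exists_signed_measure_of_twisted (hN : Even N) (hN2 : 2 < N)
    (hmk : ∀ f : ℕ → Bool, f N = f 0 → ∀ k ≤ N, val (mk f) k = f k)
    {g : ℕ → Bool} (hg : g N = !g 0) :
    ∃ y : S → ℝ, (∀ k < N, ∀ a b, edgeMarginal val k y a b =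
        if (a ^^ g k) = (b ^^ g (k + 1)) then 1 / 2 else 0) ∧
      ∑ s, |y s| ≤ (N : ℝ) / (N - 2) := by
  classical
  have hNR : (2 : ℝ) < N := by exact_mod_cast hN2
  set β : ℝ := 1 / (2 * N * (N - 2)) with hβ
  have hβ0 : 0 < β := by
    have : (0 : ℝ) < N - 2 := by linarith
    positivity
  have hβN : β * (N * (N - 2)) = 1 / 2 := by
    have : (N : ℝ) - 2 ≠ 0 := by linarith
    rw [hβ]
    field_simp
  let u : (ℕ → Bool) → ℕ → Bool → S → ℝ := fun g j c => Pi.single (mk (defectWalk g j c)) 1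
  have marg : ∀ g : ℕ → Bool, g N = !g 0 → ∀ k < N, ∀ a b,
      edgeMarginal val k (∑ j ∈ range N, ∑ c, u g j c) a b =
        if (a ^^ g k) = (b ^^ g (k + 1)) then (N : ℝ) - 1 else 1 := by
    intro g hg k hk a b
    rw [edgeMarginal_sum, ← sum_range_iff_ne hk]
    refine sum_congr rfl fun j hj => ?_
    rw [edgeMarginal_sum, ← sum_defectWalk_indicator]
    refine sum_congr rfl fun c _ => ?_
    have hc := defectWalk_closed hg (mem_range.mp hj) c
    rw [edgeMarginal_single, hmk _ hc k hk.le, hmk _ hc (k + 1) hk]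
  have mass : ∀ g : ℕ → Bool, ∑ s, |(∑ j ∈ range N, ∑ c, u g j c) s| = 2 * N := by
    intro g
    have nonneg : ∀ s, 0 ≤ (∑ j ∈ range N, ∑ c, u g j c) s := by
      intro s
      simp only [Finset.sum_apply]
      exact sum_nonneg fun j _ => sum_nonneg fun c _ => by
        by_cases h : s = mk (defectWalk g j c) <;> simp [u, h]
    simp only [abs_of_nonneg (nonneg _)]
    simp only [Finset.sum_apply]
    rw [sum_comm]
    simp only [sum_comm (s := (univ : Finset S))]
    simp [u, mul_comm]
  refine ⟨((N - 1) * β) • (∑ j ∈ range N, ∑ c, u g j c) +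
    (-β) • ∑ j ∈ range N, ∑ c, u (alternate g) j c, fun k hk a b => ?_, ?_⟩
  · rw [edgeMarginal_add, edgeMarginal_smul, edgeMarginal_smul, marg g hg k hk,
      marg _ (alternate_twisted hN hg) k hk]
    simp only [xor_alternate_eq_iff]
    by_cases h : (a ^^ g k) = (b ^^ g (k + 1))
    · simp only [h, if_true, not_true, if_false]
      linear_combination hβN
    · simp only [h, if_false, not_false_iff, if_true]
      ring
  · calc _ ≤ ∑ s, (((N : ℝ) - 1) * β * |(∑ j ∈ range N, ∑ c, u g j c) s| +
            β * |(∑ j ∈ range N, ∑ c, u (alternate g) j c) s|) := by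
          refine sum_le_sum fun s _ => (abs_add_le _ _).trans_eq ?_
          simp only [Pi.smul_apply, smul_eq_mul, abs_mul, abs_neg, abs_of_pos hβ0]
          rw [abs_of_nonneg (by linarith : (0 : ℝ) ≤ N - 1)]
      _ = (N : ℝ) / (N - 2) := by
          rw [sum_add_distrib, ← mul_sum, ← mul_sum, mass, mass, hβ]
          have : (N : ℝ) - 2 ≠ 0 := by linarith
          field_simp
          ring

/-- Nonnegative measures whose edge marginals are dominated by `p`. -/
def IsPacking (N : ℕ) (val : S → ℕ → Bool) (p : ℕ → Bool → Bool → ℝ) (z : S → ℝ) : Prop :=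
  (∀ s, 0 ≤ z s) ∧ ∀ k < N, ∀ a b, edgeMarginal val k z a b ≤ p k a b

/-- Packings of maximal total mass. -/
def IsMaxPacking (N : ℕ) (val : S → ℕ → Bool) (p : ℕ → Bool → Bool → ℝ) (z : S → ℝ) : Prop :=
  IsPacking N val p z ∧ ∀ z', IsPacking N val p z' → ∑ s, z' s ≤ ∑ s, z s

variable {p : ℕ → Bool → Bool → ℝ}

lemma exists_isMaxPacking (hN : 0 < N) (nonneg : ∀ k a b, 0 ≤ p k a b)
    (total : ∀ k, ∑ a, ∑ b, p k a b = 1) : ∃ z, IsMaxPacking N val p z := by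
  have hclosed : IsClosed {z | IsPacking N val p z} := by
    simp only [IsPacking, edgeMarginal, Set.ofPred_and, Set.ofPred_forall]
    refine IsClosed.inter (isClosed_iInter fun s => isClosed_le continuous_const
      (continuous_apply s)) ?_
    refine isClosed_iInter fun k => isClosed_iInter fun _ => isClosed_iInter fun a =>
      isClosed_iInter fun b => isClosed_le (continuous_finsetSum _ fun s _ => ?_) continuous_const
    split_ifs
    · exact continuous_apply s
    · exact continuous_const
  have hsub : {z | IsPacking N val p z} ⊆ Set.Icc 0 1 := by
    intro z hz
    refine ⟨hz.1, fun s => ?_⟩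
    calc z s ≤ ∑ s, z s := single_le_sum (fun s _ => hz.1 s) (mem_univ s)
      _ = ∑ a, ∑ b, edgeMarginal val 0 z a b := (sum_edgeMarginal val 0 z).symm
      _ ≤ ∑ a, ∑ b, p 0 a b := sum_le_sum fun a _ => sum_le_sum fun b _ => hz.2 0 hN a b
      _ = 1 := total 0
  have hne : {z | IsPacking N val p z}.Nonempty :=
    ⟨0, fun _ => le_rfl, fun k _ a b => by simpa [edgeMarginal] using nonneg k a b⟩
  obtain ⟨z, hz, hmax⟩ := (isCompact_Icc.of_isClosed_subset hclosed hsub).exists_isMaxOn hne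
    (f := fun z => ∑ s, z s) (by fun_prop)
  exact ⟨z, hz, fun z' hz' => hmax hz'⟩

lemma IsMaxPacking.exists_residual_le (hN : 0 < N)
    (hmk : ∀ f : ℕ → Bool, f N = f 0 → ∀ k ≤ N, val (mk f) k = f k)
    {z : S → ℝ} (hz : IsMaxPacking N val p z) {f : ℕ → Bool} (hf : f N = f 0) :
    ∃ k < N, p k (f k) (f (k + 1)) - edgeMarginal val k z (f k) (f (k + 1)) ≤ 0 := by
  classical
  by_contra! h
  obtain ⟨i, hi, hmin⟩ := (range N).exists_min_image
    (fun k => p k (f k) (f (k + 1)) - edgeMarginal val k z (f k) (f (k + 1)))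
    ⟨0, mem_range.mpr hN⟩
  set δ := p i (f i) (f (i + 1)) - edgeMarginal val i z (f i) (f (i + 1))
  have hδ : 0 < δ := h i (mem_range.mp hi)
  have := hz.2 (z + δ • Pi.single (mk f) 1) ⟨fun s => ?_, fun k hk a b => ?_⟩
  · simp [sum_add_distrib, Pi.single_apply] at this
    linarith
  · have := hz.1.1 s
    by_cases hs : s = mk f
    · subst hs
      simp
      linarith
    · simpa [hs] using this
  · rw [edgeMarginal_add, edgeMarginal_smul, edgeMarginal_single, hmk f hf k hk.le,
      hmk f hf (k + 1) hk]
    have := hz.1.2 k hk a b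
    have hk' := hmin k (mem_range.mpr hk)
    split_ifs with hab
    · obtain ⟨rfl, rfl⟩ := hab
      linarith
    · linarith

lemma IsMaxPacking.card_out_of_phase_le
    (hmk : ∀ f : ℕ → Bool, f N = f 0 → ∀ k ≤ N, val (mk f) k = f k)
    {z : S → ℝ} (hz : IsMaxPacking N val p z) {g : ℕ → Bool} (hg : g N = !g 0) {ε : ℝ}
    (hε : 0 < ε)
    (hr : ∀ k < N, ∀ a b, p k a b - edgeMarginal val k z a b =
      if (a ^^ g k) = (b ^^ g (k + 1)) then ε / 2 else 0)
    {s : S} (hs : 0 < z s) :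
    #{k ∈ range N | ¬ (val s k ^^ g k) = (val s (k + 1) ^^ g (k + 1))} ≤ 1 := by
  classical
  refine card_le_one.mpr fun i hi j hj => ?_
  by_contra hij
  simp only [mem_filter, mem_range] at hi hj
  obtain ⟨hiN, hi⟩ := hi
  obtain ⟨hjN, hj⟩ := hj
  let w : ℕ → ℕ → Bool := fun i => defectWalk g i (val s i ^^ g i)
  set δ := min (z s) (ε / 4)
  have hδ : 0 < δ := lt_min hs (by linarith)
  have hδs : δ ≤ z s := min_le_left _ _
  have hδε : δ ≤ ε / 4 := min_le_right _ _
  have := hz.2 (z + δ • ((-1 : ℝ) • Pi.single s 1 + Pi.single (mk (w i)) 1 +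
    Pi.single (mk (w j)) 1)) ⟨fun t => ?_, fun k hk a b => ?_⟩
  · simp [sum_add_distrib, Pi.single_apply] at this
    linarith
  · have hzt := hz.1.1 t
    have h₁ : 0 ≤ (Pi.single (mk (w i)) 1 : S → ℝ) t := by
      rw [Pi.single_apply]; split_ifs <;> norm_num
    have h₂ : 0 ≤ (Pi.single (mk (w j)) 1 : S → ℝ) t := by
      rw [Pi.single_apply]; split_ifs <;> norm_num
    have h₃ : 0 ≤ z t + δ * (-1 * (Pi.single s 1 : S → ℝ) t) := by
      rw [Pi.single_apply]
      split_ifs with h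
      · subst h; linarith
      · linarith
    simp only [Pi.add_apply, Pi.smul_apply, smul_eq_mul]
    nlinarith
  · have hclosed : ∀ i < N, w i N = w i 0 := fun i hi => defectWalk_closed hg hi _
    simp only [edgeMarginal_add, edgeMarginal_smul, edgeMarginal_single]
    rw [hmk _ (hclosed i hiN) k hk.le, hmk _ (hclosed i hiN) (k + 1) hk,
      hmk _ (hclosed j hjN) k hk.le, hmk _ (hclosed j hjN) (k + 1) hk]
    have hrk := hr k hk a b
    by_cases hab : (a ^^ g k) = (b ^^ g (k + 1))
    · rw [if_pos hab] at hrk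
      have h₁ : (if val s k = a ∧ val s (k + 1) = b then (1 : ℝ) else 0) ≥ 0 := by
        split_ifs <;> norm_num
      have h₂ : ∀ i, (if w i k = a ∧ w i (k + 1) = b then (1 : ℝ) else 0) ≤ 1 := by
        intro i; split_ifs <;> norm_num
      nlinarith [h₁, h₂ i, h₂ j]
    · rw [if_neg hab] at hrk
      have key : ∀ i, ¬ (val s i ^^ g i) = (val s (i + 1) ^^ g (i + 1)) →
          w i k = a ∧ w i (k + 1) = b → k = i ∧ val s k = a ∧ val s (k + 1) = b := by
        rintro i hi ⟨rfl, rfl⟩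
        have hki : k = i := by
          by_contra h
          exact hab ((xor_defectWalk_eq_iff g i _ k).mpr h)
        subst hki
        exact ⟨rfl, (defectWalk_self hi).1.symm, (defectWalk_self hi).2.symm⟩
      have hle : (if w i k = a ∧ w i (k + 1) = b then (1 : ℝ) else 0) +
          (if w j k = a ∧ w j (k + 1) = b then (1 : ℝ) else 0) ≤
          if val s k = a ∧ val s (k + 1) = b then (1 : ℝ) else 0 := by
        by_cases h₁ : w i k = a ∧ w i (k + 1) = b
        · have h₂ : ¬ (w j k = a ∧ w j (k + 1) = b) := fun h₂ =>
            hij ((key i hi h₁).1.symm.trans (key j hj h₂).1)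
          rw [if_pos h₁, if_neg h₂, if_pos (key i hi h₁).2, add_zero]
        · by_cases h₂ : w j k = a ∧ w j (k + 1) = b
          · rw [if_neg h₁, if_pos h₂, if_pos (key j hj h₂).2, zero_add]
          · rw [if_neg h₁, if_neg h₂]
            split_ifs <;> norm_num
      nlinarith

/-- The maximal packing mass `1 - ε` of an even cycle determines the minimal total variation
`1 + 2 ε / (N - 2)` of a signed measure with the same edge marginals. -/
theorem exists_packing_deficit (hN : Even N) (hN2 : 2 < N)
    (hmk : ∀ f : ℕ → Bool, f N = f 0 → ∀ k ≤ N, val (mk f) k = f k)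
    (hval : ∀ s k, val s (k + N) = val s k)
    (nonneg : ∀ k a b, 0 ≤ p k a b) (total : ∀ k, ∑ a, ∑ b, p k a b = 1)
    (cons : ∀ k b, ∑ a, p k a b = ∑ c, p (k + 1) b c) (per : p N = p 0) :
    ∃ ε : ℝ, IsGreatest {t : ℝ | ∃ z, IsPacking N val p z ∧ t = ∑ s, z s} (1 - ε) ∧
      IsLeast {t : ℝ | ∃ y : S → ℝ, (∀ k < N, ∀ a b, edgeMarginal val k y a b = p k a b) ∧
        t = ∑ s, |y s|} (1 + 2 * ε / (N - 2)) := by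
  have hNR : (2 : ℝ) < N := by exact_mod_cast hN2
  have hN0 : 0 < N := by omega
  obtain ⟨z, hz⟩ := exists_isMaxPacking (val := val) hN0 nonneg total
  have hsum : ∀ k, ∑ a, ∑ b, (p k a b - edgeMarginal val k z a b) = 1 - ∑ s, z s := by
    intro k
    simp only [sum_sub_distrib, total, sum_edgeMarginal]
  have hr0 : ∀ k < N, ∀ a b, 0 ≤ p k a b - edgeMarginal val k z a b := fun k hk a b =>
    sub_nonneg.mpr (hz.1.2 k hk a b)
  have hpos : 0 ≤ 1 - ∑ s, z s := by
    rw [← hsum 0]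
    exact sum_nonneg fun a _ => sum_nonneg fun b _ => hr0 0 hN0 a b
  have hzabs : ∑ s, |z s| = ∑ s, z s := sum_congr rfl fun s _ => abs_of_nonneg (hz.1.1 s)
  refine ⟨1 - ∑ s, z s, ⟨⟨z, hz.1, by ring⟩, ?_⟩, ?_⟩
  · rintro t ⟨z', hz', rfl⟩
    simpa using hz.2 z' hz'
  rcases hpos.eq_or_lt with hε | hε
  · rw [← hε, mul_zero, zero_div, add_zero]
    constructor
    · refine ⟨z, fun k hk a b => ?_, by linarith⟩
      have h₁ := hsum k
      rw [← hε, sum_eq_zero_iff_of_nonneg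
        fun a _ => sum_nonneg fun b _ => hr0 k hk a b] at h₁
      have h₂ := (sum_eq_zero_iff_of_nonneg fun b _ => hr0 k hk a b).mp (h₁ a (mem_univ a)) b
        (mem_univ b)
      linarith
    · rintro t ⟨y, hy, rfl⟩
      calc (1 : ℝ) = ∑ a, ∑ b, edgeMarginal val 0 y a b := by simp only [hy 0 hN0, total]
        _ = ∑ s, y s := sum_edgeMarginal val 0 y
        _ ≤ ∑ s, |y s| := sum_le_sum fun s _ => le_abs_self _
  set ε := 1 - ∑ s, z s with hεdef
  have hvN : ∀ s, val s N = val s 0 := fun s => by simpa using hval s 0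
  obtain ⟨g, hg, hr⟩ := exists_twisted_walk hε
    (fun k a b => p k a b - edgeMarginal val k z a b) hr0
    (fun k b => by simp only [sum_sub_distrib, cons k b, sum_fst_edgeMarginal])
    (by
      have h₁ : ∀ s, val s (N + 1) = val s (0 + 1) := fun s => by
        rw [add_comm N 1, hval]
      funext a b
      simp only [per, edgeMarginal, hvN, h₁])
    (hsum 0) (fun f hf => hz.exists_residual_le hN0 hmk hf)
  have hN2' : (N : ℝ) - 2 ≠ 0 := by linarith
  have lower : ∀ y : S → ℝ, (∀ k < N, ∀ a b, edgeMarginal val k y a b = p k a b) →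
      1 + 2 * ε / (N - 2) ≤ ∑ s, |y s| := by
    intro y hy
    let F : S → ℝ := fun s => ∑ k ∈ range N, phaseSign g k (val s k) (val s (k + 1))
    have corr : ∀ y : S → ℝ,
        ∑ k ∈ range N, ∑ a, ∑ b, phaseSign g k a b * edgeMarginal val k y a b =
          ∑ s, F s * y s := by
      intro y
      simp only [sum_mul_edgeMarginal, F, sum_mul]
      exact sum_comm
    have residual : ∑ k ∈ range N, ∑ a, ∑ b,
        phaseSign g k a b * (p k a b - edgeMarginal val k z a b) = N * ε := by
      rw [sum_congr rfl fun k hk => ?_, sum_const, card_range, nsmul_eq_mul]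
      rw [← hsum k]
      refine sum_congr rfl fun a _ => sum_congr rfl fun b _ => ?_
      rw [hr k (mem_range.mp hk), phaseSign]
      split_ifs <;> simp
    have split : ∑ s, F s * y s = ∑ s, F s * z s + N * ε := by
      rw [← corr, ← corr, ← residual]
      simp only [← sum_add_distrib, ← mul_add]
      refine sum_congr rfl fun k hk => sum_congr rfl fun a _ => sum_congr rfl fun b _ => ?_
      rw [hy k (mem_range.mp hk)]
      ring
    have upper : ∑ s, F s * y s ≤ (N - 2) * ∑ s, |y s| := by
      rw [mul_sum]
      refine sum_le_sum fun s _ => (le_abs_self _).trans ?_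
      rw [abs_mul]
      exact mul_le_mul_of_nonneg_right (abs_sum_phaseSign_le hN hg (hvN s)) (abs_nonneg _)
    have tight : (N - 2) * ∑ s, z s ≤ ∑ s, F s * z s := by
      rw [mul_sum]
      refine sum_le_sum fun s _ => ?_
      rcases (hz.1.1 s).eq_or_lt with h | h
      · simp [← h]
      · refine mul_le_mul_of_nonneg_right ?_ h.le
        have hcard : (#{k ∈ range N | ¬ (val s k ^^ g k) = (val s (k + 1) ^^ g (k + 1))} : ℝ) ≤ 1 := by
          exact_mod_cast hz.card_out_of_phase_le hmk hg hε hr h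
        simp only [F, sum_phaseSign]
        linarith
    have : 1 + 2 * ε / (N - 2) = ((N - 2) * ∑ s, z s + N * ε) / (N - 2) := by
      rw [show ∑ s, z s = 1 - ε by rw [hεdef]; ring]
      field_simp
      ring
    rw [this, div_le_iff₀ (by linarith)]
    linarith
  refine ⟨?_, ?_⟩
  · obtain ⟨y, hy, hy'⟩ := exists_signed_measure_of_twisted hN hN2 hmk hg
    have hmarg : ∀ k < N, ∀ a b, edgeMarginal val k (z + ε • y) a b = p k a b := by
      intro k hk a b
      have h := hr k hk a b
      rw [edgeMarginal_add, edgeMarginal_smul, hy k hk]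
      split_ifs at h ⊢ <;> linarith
    refine ⟨z + ε • y, hmarg, (lower _ hmarg).antisymm ?_⟩
    calc ∑ s, |(z + ε • y) s| ≤ ∑ s, (|z s| + ε * |y s|) :=
          sum_le_sum fun s _ => (abs_add_le _ _).trans_eq (by
            rw [Pi.smul_apply, smul_eq_mul, abs_mul, abs_of_pos hε])
      _ = (1 - ε) + ε * ∑ s, |y s| := by
          rw [sum_add_distrib, ← mul_sum, hzabs, hεdef]
          ring
      _ ≤ (1 - ε) + ε * (N / (N - 2)) := by gcongr
      _ = 1 + 2 * ε / (N - 2) := by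
          field_simp
          ring
  · rintro t ⟨y, hy, rfl⟩
    exact lower y hy

end Cycle

section CyclicSystem

variable {n : ℕ} {b : Fin n → Bool → Bool → ℝ}

lemma mFst_sum (hb : IsCyclicSystem n b) (i : Fin n) : mFst b i false + mFst b i true = 1 := by
  have := hb.2 i
  simp only [Fintype.sum_bool] at this
  simp only [mFst]
  linarith

lemma mSnd_sum (hb : IsCyclicSystem n b) (i : Fin n) : mSnd b i false + mSnd b i true = 1 := by
  have := hb.2 (fpred i)
  simp only [Fintype.sum_bool] at this
  simp only [mSnd]
  linarith

lemma mmc_fst (hb : IsCyclicSystem n b) (i : Fin n) (r : Bool) :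
    ∑ r', mmc b i r r' = mFst b i r := by
  have h₁ := mFst_sum hb i
  have h₂ := mSnd_sum hb i
  cases r <;> simp only [Fintype.sum_bool, mmc]
  · rcases le_total (mFst b i true) (mSnd b i true) with h | h
    · rw [min_eq_left h, min_eq_right (by linarith)]
      linarith
    · rw [min_eq_right h, min_eq_left (by linarith)]
      linarith
  · linarith

lemma mmc_snd (hb : IsCyclicSystem n b) (i : Fin n) (r' : Bool) :
    ∑ r, mmc b i r r' = mSnd b i r' := by
  have h₁ := mFst_sum hb i
  have h₂ := mSnd_sum hb i
  cases r' <;> simp only [Fintype.sum_bool, mmc]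
  · rcases le_total (mFst b i true) (mSnd b i true) with h | h
    · rw [min_eq_left h, min_eq_right (by linarith)]
      linarith
    · rw [min_eq_right h, min_eq_left (by linarith)]
      linarith
  · linarith

lemma mmc_nonneg (hb : IsCyclicSystem n b) (i : Fin n) (r r' : Bool) : 0 ≤ mmc b i r r' := by
  have h₁ : ∀ r, 0 ≤ mFst b i r := fun r => add_nonneg (hb.1 _ _ _) (hb.1 _ _ _)
  have h₂ : ∀ r, 0 ≤ mSnd b i r := fun r => add_nonneg (hb.1 _ _ _) (hb.1 _ _ _)
  cases r <;> cases r' <;> simp only [mmc]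
  · exact le_min (h₁ _) (h₂ _)
  · exact sub_nonneg.mpr (min_le_right _ _)
  · exact sub_nonneg.mpr (min_le_left _ _)
  · exact le_min (h₁ _) (h₂ _)

/-- The context of the vertex `k` of the `2n`-cycle: vertices `2i` and `2i + 1` belong to the
context `i`. -/
def contextOf [NeZero n] (k : ℕ) : Fin n := ⟨k / 2 % n, Nat.mod_lt _ (NeZero.pos n)⟩

/-- The values of a joint state along the `2n`-cycle of random variables. -/
def stateVal [NeZero n] (s : Fin n → Bool × Bool) (k : ℕ) : Bool :=
  if k.bodd then (s (contextOf k)).2 else (s (contextOf k)).1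

/-- The bunch and connection distributions along the `2n`-cycle of random variables. -/
noncomputable def edgeDistribution [NeZero n] (b : Fin n → Bool → Bool → ℝ) (k : ℕ)
    (r r' : Bool) : ℝ :=
  if k.bodd then mmc b (fsucc (contextOf k)) r' r else b (contextOf k) r r'

lemma fpred_fsucc (i : Fin n) : fpred (fsucc i) = i := by
  have hi := i.isLt
  ext
  simp only [fpred, fsucc, Nat.mod_add_mod]
  rw [show i.val + 1 + (n - 1) = i.val + n by omega, Nat.add_mod_right, Nat.mod_eq_of_lt hi]

lemma fsucc_fpred (i : Fin n) : fsucc (fpred i) = i := by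
  have hi := i.isLt
  ext
  simp only [fpred, fsucc, Nat.mod_add_mod]
  rw [show i.val + (n - 1) + 1 = i.val + n by omega, Nat.add_mod_right, Nat.mod_eq_of_lt hi]

variable [NeZero n]

lemma contextOf_two_mul (i : Fin n) : contextOf (2 * i.val) = i := by
  ext
  simp [contextOf, Nat.mod_eq_of_lt i.isLt]

lemma contextOf_two_mul_add_one (m : ℕ) :
    contextOf (n := n) (2 * m + 1) = contextOf (2 * m) := by
  ext
  simp only [contextOf]
  congr 1
  omega

lemma contextOf_two_mul_add_two (m : ℕ) :
    contextOf (n := n) (2 * m + 1 + 1) = fsucc (contextOf (2 * m)) := by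
  ext
  simp only [contextOf, fsucc, Nat.mod_add_mod]
  congr 1
  omega

lemma contextOf_add_period (k : ℕ) : contextOf (n := n) (k + 2 * n) = contextOf k := by
  ext
  simp [contextOf, Nat.add_mul_div_left]

lemma edgeMarginal_even (m : ℕ) (y : (Fin n → Bool × Bool) → ℝ) (r r' : Bool) :
    edgeMarginal stateVal (2 * m) y r r' = Bm (contextOf (2 * m)) y r r' := by
  simp [edgeMarginal, Bm, stateVal, contextOf_two_mul_add_one, Prod.ext_iff]

lemma edgeMarginal_odd (m : ℕ) (y : (Fin n → Bool × Bool) → ℝ) (r r' : Bool) :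
    edgeMarginal stateVal (2 * m + 1) y r r' = Cm (fsucc (contextOf (2 * m))) y r' r := by
  simp [edgeMarginal, Cm, stateVal, contextOf_two_mul_add_one, contextOf_two_mul_add_two,
    fpred_fsucc, and_comm]

lemma edgeDistribution_even (b : Fin n → Bool → Bool → ℝ) (m : ℕ) (r r' : Bool) :
    edgeDistribution b (2 * m) r r' = b (contextOf (2 * m)) r r' := by
  simp [edgeDistribution]

lemma edgeDistribution_odd (b : Fin n → Bool → Bool → ℝ) (m : ℕ) (r r' : Bool) :
    edgeDistribution b (2 * m + 1) r r' = mmc b (fsucc (contextOf (2 * m))) r' r := by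
  simp [edgeDistribution, contextOf_two_mul_add_one]

/-- A relation between marginals and prescribed distributions holds for all bunches and connections
iff it holds along the `2n`-cycle. -/
lemma forall_marginals_iff (R : ℝ → ℝ → Prop) (b : Fin n → Bool → Bool → ℝ)
    (y : (Fin n → Bool × Bool) → ℝ) :
    (∀ i r r', R (Bm i y r r') (b i r r') ∧ R (Cm i y r r') (mmc b i r r')) ↔
      ∀ k < 2 * n, ∀ r r', R (edgeMarginal stateVal k y r r') (edgeDistribution b k r r') := by
  constructor
  · intro h k _ r r'
    obtain ⟨m, rfl | rfl⟩ := k.even_or_odd'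
    · rw [edgeMarginal_even, edgeDistribution_even]
      exact (h _ r r').1
    · rw [edgeMarginal_odd, edgeDistribution_odd]
      exact (h _ r' r).2
  · intro h i r r'
    have hi := i.isLt
    have hi' := (fpred i).isLt
    have h₁ := h (2 * i.val) (by omega) r r'
    have h₂ := h (2 * (fpred i).val + 1) (by omega) r' r
    rw [edgeMarginal_even, edgeDistribution_even, contextOf_two_mul] at h₁
    rw [edgeMarginal_odd, edgeDistribution_odd, contextOf_two_mul, fsucc_fpred] at h₂
    exact ⟨h₁, h₂⟩

lemma stateVal_mk {f : ℕ → Bool} (hf : f (2 * n) = f 0) {k : ℕ} (hk : k ≤ 2 * n) :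
    stateVal (fun i : Fin n => (f (2 * i.val), f (2 * i.val + 1))) k = f k := by
  obtain ⟨m, rfl | rfl⟩ := k.even_or_odd'
  · rcases (show m ≤ n by omega).lt_or_eq with hm | rfl
    · simp [stateVal, contextOf, Nat.mod_eq_of_lt hm]
    · simp [stateVal, contextOf, hf]
  · have hm : m < n := by omega
    rw [stateVal, contextOf_two_mul_add_one]
    simp [contextOf, Nat.mod_eq_of_lt hm]

lemma edgeDistribution_nonneg (hb : IsCyclicSystem n b) (k : ℕ) (r r' : Bool) :
    0 ≤ edgeDistribution b k r r' := by
  unfold edgeDistribution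
  split_ifs
  · exact mmc_nonneg hb _ _ _
  · exact hb.1 _ _ _

lemma edgeDistribution_total (hb : IsCyclicSystem n b) (k : ℕ) :
    ∑ r, ∑ r', edgeDistribution b k r r' = 1 := by
  obtain ⟨m, rfl | rfl⟩ := k.even_or_odd'
  · simp only [edgeDistribution_even, hb.2]
  · simp only [edgeDistribution_odd, mmc_snd hb, Fintype.sum_bool]
    rw [add_comm, mSnd_sum hb]

lemma edgeDistribution_consistent (hb : IsCyclicSystem n b) (k : ℕ) (r : Bool) :
    ∑ a, edgeDistribution b k a r = ∑ c, edgeDistribution b (k + 1) r c := by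
  obtain ⟨m, rfl | rfl⟩ := k.even_or_odd'
  · simp only [edgeDistribution_even, edgeDistribution_odd, mmc_snd hb, mSnd, fpred_fsucc,
      Fintype.sum_bool]
    rw [add_comm]
  · rw [show 2 * m + 1 + 1 = 2 * (m + 1) by ring]
    simp only [edgeDistribution_even, edgeDistribution_odd, mmc_fst hb, mFst, Fintype.sum_bool]
    rw [add_comm, show 2 * (m + 1) = 2 * m + 1 + 1 by ring, contextOf_two_mul_add_two]

end CyclicSystem

/-- For every cyclic system of rank `n ≥ 2`, `CNTF(b) = (n - 1) · CNT3(b)`. -/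
theorem cntf_eq_n_sub_one_mul_cnt3 (n : ℕ) (hn : 2 ≤ n)
    (b : Fin n → Bool → Bool → ℝ) (hb : IsCyclicSystem n b) :
    CNTF b = ((n : ℝ) - 1) * CNT3 b := by 
  have : NeZero n := ⟨by omega⟩
  obtain ⟨ε, hpack, hcoup⟩ := exists_packing_deficit (N := 2 * n) (val := stateVal (n := n))
    (mk := fun f i => (f (2 * i.val), f (2 * i.val + 1))) (p := edgeDistribution b)
    (even_two_mul n) (by omega) (fun f hf k hk => stateVal_mk hf hk)
    (fun s k => by simp [stateVal, contextOf_add_period, Nat.bodd_add, Nat.bodd_mul])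
    (edgeDistribution_nonneg hb) (edgeDistribution_total hb) (edgeDistribution_consistent hb) (by
      have := contextOf_add_period (n := n) 0
      rw [zero_add] at this
      funext r r'
      simp [edgeDistribution, this])
  have hF : CNTF b = ε := by
    simp only [CNTF, CNTFConstraints, forall_marginals_iff (· ≤ ·)]
    exact (congrArg (1 - ·) hpack.csSup_eq).trans (by ring)
  have h3 : CNT3 b = 2 * ε / ((2 * n : ℕ) - 2) := by
    simp only [CNT3, Feasible, forall_marginals_iff (· = ·)]
    rw [hcoup.csInf_eq]
    ring
  have hnR : (2 : ℝ) ≤ n := by exact_mod_cast hn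
  have hn1 : (n : ℝ) - 1 ≠ 0 := by linarith
  rw [hF, h3]
  push_cast
  rw [show (2 : ℝ) * n - 2 = 2 * (n - 1) by ring]
  field_simp
end

section
/- If a cyclic system b of rank n ≥ 2 is contextual, then there exists an optimal feasible signed quasi-coupling y (i.e., ∑_s |y s| = 1 + CNT3(b)) that has exactly one negative component: the set {s | y s < 0} is a singleton {v}, and moreover y v = −CNT3(b)/2. -/
open Finset

/-- Joint law of two Boolean variables on a finite signed measure space. -/
def pairLaw {Ω : Type} [Fintype Ω] (μ : Ω → ℝ) (A B : Ω → Bool) (r r' : Bool) : ℝ :=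
  ∑ ω, if A ω = r ∧ B ω = r' then μ ω else 0

/-- Mass of the event `a ⊕ b ⊕ g = 1` under a law of a pair of bits `(a, b)`. -/
def xorMass (p : Bool → Bool → ℝ) : Bool → ℝ
  | false => p true false + p false true
  | true => p true true + p false false

/-- Number of indices below `N` at which `f` is true. -/
def trueCount (f : ℕ → Bool) (N : ℕ) : ℕ := ∑ k ∈ range N, (f k).toNat

lemma xorMass_pairLaw {Ω : Type} [Fintype Ω] (μ : Ω → ℝ) (A B : Ω → Bool) (g : Bool) :
    xorMass (pairLaw μ A B) g = ∑ ω, μ ω * ((xor (xor (A ω) (B ω)) g).toNat : ℝ) := by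
  cases g <;> simp only [xorMass, pairLaw, ← Finset.sum_add_distrib] <;>
    refine Finset.sum_congr rfl fun ω _ => ?_ <;>
    cases A ω <;> cases B ω <;> simp

lemma sum_xorMass_pairLaw {Ω : Type} [Fintype Ω] (μ : Ω → ℝ) (X : ℕ → Ω → Bool)
    (γ : ℕ → Bool) (N : ℕ) :
    ∑ k ∈ range N, xorMass (pairLaw μ (X k) (X (k + 1))) (γ k) =
      ∑ ω, μ ω * (trueCount (fun k => xor (xor (X k ω) (X (k + 1) ω)) (γ k)) N : ℝ) := by
  simp only [xorMass_pairLaw, trueCount, Nat.cast_sum, Finset.mul_sum]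
  exact Finset.sum_comm

lemma trueCount_xor (f g : ℕ → Bool) (N : ℕ) :
    ∃ m, trueCount f N + trueCount g N = trueCount (fun k => xor (f k) (g k)) N + 2 * m := by
  refine ⟨trueCount (fun k => f k && g k) N, ?_⟩
  simp only [trueCount, Finset.mul_sum, ← Finset.sum_add_distrib]
  refine Finset.sum_congr rfl fun k _ => ?_
  cases f k <;> cases g k <;> simp

lemma trueCount_not (f : ℕ → Bool) (N : ℕ) :
    trueCount f N + trueCount (fun k => !f k) N = N := by
  simp only [trueCount, ← Finset.sum_add_distrib]
  rw [Finset.sum_congr rfl (g := fun _ => 1) fun k _ => by cases f k <;> simp]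
  simp

/-- The number of changes along a bit sequence is even iff its endpoints agree. -/
lemma trueCount_change (x : ℕ → Bool) (N : ℕ) :
    Even (trueCount (fun k => xor (x k) (x (k + 1))) N) ↔ x 0 = x N := by
  induction N with
  | zero => simp [trueCount]
  | succ N ih =>
    rw [trueCount] at ih ⊢
    rw [Finset.sum_range_succ, Nat.even_add, ih]
    cases x 0 <;> cases x N <;> cases x (N + 1) <;> simp

/-- An odd sign pattern disagrees with every closed bit sequence on an odd number of edges, and
if the cycle is even the same holds for agreements. -/
lemma trueCount_closed {N : ℕ} (hN : Even N) {γ : ℕ → Bool} (hγ : Odd (trueCount γ N))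
    {x : ℕ → Bool} (hx : x 0 = x N) :
    1 ≤ trueCount (fun k => xor (xor (x k) (x (k + 1))) (γ k)) N ∧
      trueCount (fun k => xor (xor (x k) (x (k + 1))) (γ k)) N + 1 ≤ N := by
  have h1 := (trueCount_change x N).2 hx
  obtain ⟨m, hm⟩ := trueCount_xor (fun k => xor (x k) (x (k + 1))) γ N
  have h2 := trueCount_not (fun k => xor (xor (x k) (x (k + 1))) (γ k)) N
  grind

/-- Conditionally independent extension of a measure by one more bit. -/
lemma exists_extension {Ω : Type} [Fintype Ω] {μ : Ω → ℝ} (hμ : ∀ ω, 0 ≤ μ ω) (A B : Ω → Bool)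
    {r : Bool → Bool → Bool → ℝ} (hr : ∀ a b c, 0 ≤ r a b c)
    (h : ∀ a b, pairLaw μ A B a b = r a b false + r a b true) :
    ∃ ν : Ω × Bool → ℝ, (∀ ω, 0 ≤ ν ω) ∧ (∀ ω, ν (ω, false) + ν (ω, true) = μ ω) ∧
      ∀ a b c, (∑ ω, if A ω = a ∧ B ω = b then ν (ω, c) else 0) = r a b c := by
  have hnn : ∀ a b, 0 ≤ pairLaw μ A B a b := fun a b =>
    Finset.sum_nonneg fun ω _ => by split_ifs <;> simp [hμ]
  refine ⟨fun w => μ w.1 * (r (A w.1) (B w.1) w.2 / pairLaw μ A B (A w.1) (B w.1)),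
    fun w => mul_nonneg (hμ _) (div_nonneg (hr _ _ _) (hnn _ _)), fun ω => ?_, fun a b c => ?_⟩
  · by_cases h0 : pairLaw μ A B (A ω) (B ω) = 0
    · have := (Finset.sum_eq_zero_iff_of_nonneg
        (fun ω _ => by split_ifs <;> simp [hμ])).1 h0 ω (mem_univ _)
      simp_all
    · rw [← mul_add, ← add_div, ← h, div_self h0, mul_one]
  · have : ∀ ω, (if A ω = a ∧ B ω = b then
        μ ω * (r (A ω) (B ω) c / pairLaw μ A B (A ω) (B ω)) else 0) =
        (if A ω = a ∧ B ω = b then μ ω else 0) * (r a b c / pairLaw μ A B a b) := by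
      intro ω
      split_ifs with hab
      · rw [hab.1, hab.2]
      · simp
    simp only [this, ← Finset.sum_mul]
    change pairLaw μ A B a b * _ = _
    by_cases h0 : pairLaw μ A B a b = 0
    · have h1 := h a b
      have := hr a b false
      have := hr a b true
      rw [h0, zero_mul]
      cases c <;> linarith
    · field_simp

/-- Three pairwise consistent laws of bits satisfying the triangle inequalities have a joint
law. -/
lemma exists_triple_law {T : ℝ} {p q s : Bool → Bool → ℝ}
    (hp : ∀ a b, 0 ≤ p a b) (hq : ∀ a b, 0 ≤ q a b) (hs : ∀ a b, 0 ≤ s a b)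
    (hT : p true true + p true false + p false true + p false false = T)
    (hpq : ∀ b, p false b + p true b = q b false + q b true)
    (hps : ∀ a, p a false + p a true = s a false + s a true)
    (hqs : ∀ c, q false c + q true c = s false c + s true c)
    (h1 : xorMass p false ≤ xorMass q false + xorMass s false)
    (h2 : xorMass q false ≤ xorMass p false + xorMass s false)
    (h3 : xorMass s false ≤ xorMass p false + xorMass q false)
    (h4 : xorMass p false + xorMass q false + xorMass s false ≤ 2 * T) :
    ∃ r : Bool → Bool → Bool → ℝ, (∀ a b c, 0 ≤ r a b c) ∧
      (∀ a b, r a b false + r a b true = p a b) ∧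
      (∀ b c, r false b c + r true b c = q b c) ∧
      (∀ a c, r a false c + r a true c = s a c) := by
  simp only [Bool.forall_bool, xorMass] at *
  obtain ⟨t, ht⟩ : ∃ t, 0 ≤ t ∧ p true true - s true false ≤ t ∧
      p true true - q true false ≤ t ∧ q true true - s false true ≤ t ∧
      t ≤ p true true ∧ t ≤ q true true ∧ t ≤ s true true ∧
      t ≤ p false false - s false true + q true true := by
    refine ⟨max (max 0 (p true true - s true false))
      (max (p true true - q true false) (q true true - s false true)), ?_⟩
    simp only [le_max_iff, max_le_iff]
    refine ⟨by simp, by simp, by simp, by simp, ?_, ?_, ?_, ?_⟩ <;>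
      refine ⟨⟨?_, ?_⟩, ?_, ?_⟩ <;> linarith
  refine ⟨fun a b c => match a, b, c with
    | true, true, true => t
    | true, true, false => p true true - t
    | true, false, true => s true true - t
    | false, true, true => q true true - t
    | true, false, false => s true false - p true true + t
    | false, true, false => q true false - p true true + t
    | false, false, true => s false true - q true true + t
    | false, false, false => p false false - s false true + q true true - t, ?_⟩
  simp only
  refine ⟨⟨⟨⟨?_, ?_⟩, ?_, ?_⟩, ⟨?_, ?_⟩, ?_, ?_⟩, ⟨⟨?_, ?_⟩, ?_, ?_⟩, ⟨⟨?_, ?_⟩, ?_, ?_⟩,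
    ⟨?_, ?_⟩, ?_, ?_⟩ <;> linarith

/-- Cheapest values of `∑ k ≤ K, xorMass (p k) (γ k)` over sign patterns `γ` with an even,
respectively odd, number of true values. -/
noncomputable def parityCost (p : ℕ → Bool → Bool → ℝ) : ℕ → ℝ × ℝ
  | 0 => (xorMass (p 0) false, xorMass (p 0) true)
  | K + 1 => (min ((parityCost p K).1 + xorMass (p (K + 1)) false)
        ((parityCost p K).2 + xorMass (p (K + 1)) true),
      min ((parityCost p K).2 + xorMass (p (K + 1)) false)
        ((parityCost p K).1 + xorMass (p (K + 1)) true))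

lemma exists_extend_pattern (p : ℕ → Bool → Bool → ℝ) (K : ℕ) (γ : ℕ → Bool) (g : Bool) :
    ∃ γ', trueCount γ' (K + 1) = trueCount γ K + g.toNat ∧
      ∑ k ∈ range (K + 1), xorMass (p k) (γ' k) =
        ∑ k ∈ range K, xorMass (p k) (γ k) + xorMass (p K) g := by
  have h : ∀ k ∈ range K, Function.update γ K g k = γ k := fun k hk =>
    Function.update_of_ne (Finset.mem_range.1 hk).ne _ _
  refine ⟨Function.update γ K g, ?_, ?_⟩
  · rw [trueCount, trueCount, Finset.sum_range_succ, Function.update_self,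
      Finset.sum_congr rfl fun k hk => by rw [h k hk]]
  · rw [Finset.sum_range_succ, Function.update_self,
      Finset.sum_congr rfl fun k hk => by rw [h k hk]]

lemma parityCost_attained (p : ℕ → Bool → Bool → ℝ) (K : ℕ) :
    (∃ γ, Even (trueCount γ (K + 1)) ∧
      ∑ k ∈ range (K + 1), xorMass (p k) (γ k) = (parityCost p K).1) ∧
    ∃ γ, Odd (trueCount γ (K + 1)) ∧
      ∑ k ∈ range (K + 1), xorMass (p k) (γ k) = (parityCost p K).2 := by
  induction K with
  | zero =>
    exact ⟨⟨fun _ => false, by simp [trueCount], by simp [parityCost]⟩,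
      ⟨fun _ => true, by simp [trueCount], by simp [parityCost]⟩⟩
  | succ K ih =>
    obtain ⟨⟨γ₀, h₀, e₀⟩, γ₁, h₁, e₁⟩ := ih
    simp only [parityCost]
    constructor
    · rcases min_choice ((parityCost p K).1 + xorMass (p (K + 1)) false)
        ((parityCost p K).2 + xorMass (p (K + 1)) true) with h | h <;> rw [h]
      · obtain ⟨γ, hc, hs⟩ := exists_extend_pattern p (K + 1) γ₀ false
        exact ⟨γ, by simpa [hc] using h₀, by rw [hs, e₀]⟩
      · obtain ⟨γ, hc, hs⟩ := exists_extend_pattern p (K + 1) γ₁ true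
        exact ⟨γ, by rw [hc]; exact h₁.add_odd odd_one, by rw [hs, e₁]⟩
    · rcases min_choice ((parityCost p K).2 + xorMass (p (K + 1)) false)
        ((parityCost p K).1 + xorMass (p (K + 1)) true) with h | h <;> rw [h]
      · obtain ⟨γ, hc, hs⟩ := exists_extend_pattern p (K + 1) γ₁ false
        exact ⟨γ, by simpa [hc] using h₁, by rw [hs, e₁]⟩
      · obtain ⟨γ, hc, hs⟩ := exists_extend_pattern p (K + 1) γ₀ true
        exact ⟨γ, by rw [hc]; exact h₀.add_odd odd_one, by rw [hs, e₀]⟩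

lemma parityCost_bounds {p : ℕ → Bool → Bool → ℝ} {T : ℝ} (hp : ∀ k a b, 0 ≤ p k a b)
    (hT : ∀ k, p k true true + p k true false + p k false true + p k false false = T) {K : ℕ}
    (hc : ∀ k < K, ∀ b, p k false b + p k true b = p (k + 1) b false + p (k + 1) b true) :
    |(p 0 true false + p 0 true true) - (p K false true + p K true true)| ≤ (parityCost p K).1 ∧
    |T - (p 0 true false + p 0 true true) - (p K false true + p K true true)| ≤
      (parityCost p K).2 ∧
    T ≤ (parityCost p K).1 + (parityCost p K).2 := by
  simp only [Bool.forall_bool] at hp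
  induction K with
  | zero =>
    simp only [parityCost, xorMass, abs_le]
    have := hp 0
    have := hT 0
    refine ⟨⟨?_, ?_⟩, ⟨?_, ?_⟩, ?_⟩ <;> linarith
  | succ K ih =>
    obtain ⟨h1, h2, h3⟩ := ih fun k hk => hc k (hk.trans K.lt_succ_self)
    have := hc K K.lt_succ_self
    simp only [Bool.forall_bool] at this
    have := hp (K + 1)
    have := hT (K + 1)
    have := hT K
    have h0 := hT 0
    simp only [parityCost, xorMass, abs_le, le_min_iff, ← min_add_add_left, ← min_add_add_right]
      at *
    refine ⟨⟨⟨?_, ?_⟩, ?_, ?_⟩, ⟨⟨?_, ?_⟩, ?_, ?_⟩, ⟨?_, ?_⟩, ?_, ?_⟩ <;> linarith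

/-- A path of consistent pair laws has a joint law with prescribed law of the endpoints as soon as
the endpoint law satisfies the cycle inequalities. -/
lemma exists_path_law {p : ℕ → Bool → Bool → ℝ} {T : ℝ} (hp : ∀ k a b, 0 ≤ p k a b)
    (hT : ∀ k, p k true true + p k true false + p k false true + p k false false = T) (K : ℕ)
    (hc : ∀ k < K, ∀ b, p k false b + p k true b = p (k + 1) b false + p (k + 1) b true)
    {q : Bool → Bool → ℝ} (hq : ∀ a b, 0 ≤ q a b)
    (hq0 : ∀ a, q a false + q a true = p 0 a false + p 0 a true)
    (hqK : ∀ b, q false b + q true b = p K false b + p K true b)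
    (hE : xorMass q false ≤ (parityCost p K).1) (hO : xorMass q true ≤ (parityCost p K).2) :
    ∃ (Ω : Type) (_ : Fintype Ω) (μ : Ω → ℝ) (X : ℕ → Ω → Bool), (∀ ω, 0 ≤ μ ω) ∧
      (∀ k ≤ K, pairLaw μ (X k) (X (k + 1)) = p k) ∧ pairLaw μ (X 0) (X (K + 1)) = q := by
  induction K generalizing q with
  | zero =>
    have hqp : q = p 0 := by
      simp only [Bool.forall_bool, parityCost, xorMass] at *
      funext a b
      cases a <;> cases b <;> linarith
    have hl : pairLaw (fun w : Bool × Bool => p 0 w.1 w.2) Prod.fst Prod.snd = p 0 := by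
      funext a b
      cases a <;> cases b <;> simp [pairLaw, Fintype.sum_prod_type]
    refine ⟨Bool × Bool, inferInstance, fun w => p 0 w.1 w.2,
      fun k => if k = 0 then Prod.fst else Prod.snd, fun w => hp _ _ _, ?_, ?_⟩
    · simpa using hl
    · simpa [hqp] using hl
  | succ K ih =>
    have hc' : ∀ k < K, ∀ b, p k false b + p k true b = p (k + 1) b false + p (k + 1) b true :=
      fun k hk => hc k (hk.trans K.lt_succ_self)
    obtain ⟨hb1, hb2, hb3⟩ := parityCost_bounds hp hT hc'
    have hcK := hc K K.lt_succ_self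
    obtain ⟨q', hq', hq0', hqK', hE', hO', h1, h2, h3, h4⟩ : ∃ q' : Bool → Bool → ℝ,
        (∀ a b, 0 ≤ q' a b) ∧
        (∀ a, q' a false + q' a true = p 0 a false + p 0 a true) ∧
        (∀ b, q' false b + q' true b = p K false b + p K true b) ∧
        xorMass q' false ≤ (parityCost p K).1 ∧ xorMass q' true ≤ (parityCost p K).2 ∧
        xorMass q' false ≤ xorMass (p (K + 1)) false + xorMass q false ∧
        xorMass (p (K + 1)) false ≤ xorMass q' false + xorMass q false ∧
        xorMass q false ≤ xorMass q' false + xorMass (p (K + 1)) false ∧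
        xorMass q' false + xorMass (p (K + 1)) false + xorMass q false ≤ 2 * T := by
      have hpK := hp K
      have hpK1 := hp (K + 1)
      have hp0 := hp 0
      have hTK := hT K
      have hTK1 := hT (K + 1)
      have hT0 := hT 0
      clear ih hc hc' hp hT
      simp only [Bool.forall_bool, parityCost, xorMass, abs_le, le_min_iff] at *
      generalize (parityCost p K).1 = E at *
      generalize (parityCost p K).2 = O at *
      obtain ⟨a, ha⟩ : ∃ a, a = p 0 true false + p 0 true true := ⟨_, rfl⟩
      obtain ⟨c, hc⟩ : ∃ c, c = p K false true + p K true true := ⟨_, rfl⟩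
      obtain ⟨d, hd⟩ : ∃ d, d = p (K + 1) true false + p (K + 1) false true := ⟨_, rfl⟩
      obtain ⟨e, he⟩ : ∃ e, e = q true false + q false true := ⟨_, rfl⟩
      obtain ⟨t, ht⟩ : ∃ t, a - c ≤ t ∧ c - a ≤ t ∧ T - O ≤ t ∧ e - d ≤ t ∧ d - e ≤ t ∧
          t ≤ a + c ∧ t ≤ 2 * T - a - c ∧ t ≤ E ∧ t ≤ e + d ∧ t ≤ 2 * T - d - e := by
        refine ⟨max (max (a - c) (c - a)) (max (T - O) (max (e - d) (d - e))), ?_⟩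
        simp only [le_max_iff, max_le_iff]
        refine ⟨by simp, by simp, by simp, by simp, by simp, ?_, ?_, ?_, ?_, ?_⟩ <;>
          refine ⟨⟨?_, ?_⟩, ?_, ?_, ?_⟩ <;> linarith
      refine ⟨fun x y => match x, y with
        | true, true => (a + c - t) / 2
        | true, false => (a - c + t) / 2
        | false, true => (c - a + t) / 2
        | false, false => T - (a + c + t) / 2, ?_⟩
      refine ⟨⟨⟨?_, ?_⟩, ?_, ?_⟩, ⟨?_, ?_⟩, ⟨?_, ?_⟩, ?_, ?_, ?_, ?_, ?_, ?_⟩ <;> linarith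
    obtain ⟨Ω, _, μ, X, hμ, hX, hX0⟩ := ih hc' hq' hq0' hqK' hE' hO'
    obtain ⟨r, hr, hr1, hr2, hr3⟩ := exists_triple_law hq' (hp (K + 1)) hq
      (T := T) (by
        have := hT 0
        have := hq0' true
        have := hq0' false
        linarith)
      (fun b => by rw [hqK', hcK]) (fun a => by rw [hq0', hq0]) (fun c => by rw [hqK])
      h1 h2 h3 h4
    obtain ⟨ν, hν, hν1, hν2⟩ := exists_extension hμ (X 0) (X (K + 1)) hr
      (fun a b => by rw [hX0, hr1])
    refine ⟨Ω × Bool, inferInstance, ν, fun k w => if k = K + 2 then w.2 else X k w.1, hν, ?_, ?_⟩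
    · intro k hk
      rcases hk.lt_or_eq with hk | rfl
      · have e1 : k ≠ K + 2 := by omega
        have e2 : k + 1 ≠ K + 2 := by omega
        rw [← hX k (by omega)]
        funext a b
        simp only [pairLaw, Fintype.sum_prod_type, Fintype.sum_bool, e1, e2, if_false]
        refine Finset.sum_congr rfl fun ω _ => ?_
        split_ifs <;> simp [← hν1, add_comm]
      · funext b c
        rw [← hr2, ← hν2, ← hν2, ← Finset.sum_add_distrib]
        simp only [pairLaw, Fintype.sum_prod_type, Fintype.sum_bool]
        refine Finset.sum_congr rfl fun ω _ => ?_
        cases b <;> cases c <;> cases X 0 ω <;> cases X (K + 1) ω <;> simp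
    · funext a c
      rw [← hr3, ← hν2, ← hν2, ← Finset.sum_add_distrib]
      simp only [pairLaw, Fintype.sum_prod_type, Fintype.sum_bool]
      refine Finset.sum_congr rfl fun ω _ => ?_
      cases a <;> cases c <;> cases X 0 ω <;> cases X (K + 1) ω <;> simp

/-- Consistent pair laws along a cycle satisfying all cycle inequalities have a joint law. -/
lemma exists_cycle_law {p : ℕ → Bool → Bool → ℝ} {T : ℝ} {N : ℕ} (hN : 2 ≤ N)
    (hp : ∀ k a b, 0 ≤ p k a b)
    (hT : ∀ k, p k true true + p k true false + p k false true + p k false false = T)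
    (hc : ∀ k b, p k false b + p k true b = p (k + 1) b false + p (k + 1) b true)
    (hper : p N = p 0)
    (h : ∀ γ, Odd (trueCount γ N) → T ≤ ∑ k ∈ range N, xorMass (p k) (γ k)) :
    ∃ (Ω : Type) (_ : Fintype Ω) (μ : Ω → ℝ) (X : ℕ → Ω → Bool), (∀ ω, 0 ≤ μ ω) ∧
      X N = X 0 ∧ ∀ k < N, pairLaw μ (X k) (X (k + 1)) = p k := by
  obtain ⟨K, rfl⟩ : ∃ K, N = K + 1 + 1 := ⟨N - 2, by omega⟩
  obtain ⟨⟨γ₀, h₀, e₀⟩, γ₁, h₁, e₁⟩ := parityCost_attained p K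
  have hTK := hT (K + 1)
  obtain ⟨Ω, i, μ, X, hμ, hX, hX0⟩ := exists_path_law hp hT K (fun k _ => hc k)
    (q := fun a b => p (K + 1) b a) (fun a b => hp _ _ _)
    (fun a => by rw [hc (K + 1), hper]) (fun b => by rw [hc K])
    (by
      obtain ⟨γ, hγ, hs⟩ := exists_extend_pattern p (K + 1) γ₀ true
      have := h γ (by rw [hγ]; exact h₀.add_odd odd_one)
      rw [hs, e₀] at this
      simp only [xorMass] at this ⊢
      linarith)
    (by
      obtain ⟨γ, hγ, hs⟩ := exists_extend_pattern p (K + 1) γ₁ false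
      have := h γ (by rw [hγ]; exact h₁)
      rw [hs, e₁] at this
      simp only [xorMass] at this ⊢
      linarith)
  refine ⟨Ω, i, μ, fun k => if k = K + 2 then X 0 else X k, hμ, by simp, fun k hk => ?_⟩
  rcases (Nat.lt_succ_iff.1 hk).lt_or_eq with hk | rfl
  · have e1 : k ≠ K + 2 := by omega
    have e2 : k ≠ K + 1 := by omega
    simpa [e1, e2] using hX k (by omega)
  · funext a b
    rw [← congrFun₂ hX0 b a]
    simp [pairLaw, and_comm]

/-- The class of a natural number in `Fin n`. -/
def finMod {n : ℕ} (hn : 0 < n) (m : ℕ) : Fin n := ⟨m % n, Nat.mod_lt _ hn⟩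

lemma finMod_val {n : ℕ} (hn : 0 < n) (i : Fin n) : finMod hn i.val = i :=
  Fin.ext (Nat.mod_eq_of_lt i.isLt)

lemma finMod_self {n : ℕ} (hn : 0 < n) : finMod hn n = finMod hn 0 := by
  simp [finMod]

lemma fpred_finMod_succ {n : ℕ} (hn : 0 < n) (m : ℕ) : fpred (finMod hn (m + 1)) = finMod hn m := by
  apply Fin.ext
  simp only [fpred, finMod, Nat.mod_add_mod]
  rw [show m + 1 + (n - 1) = m + n by omega, Nat.add_mod_right]

lemma finMod_fpred_succ {n : ℕ} (hn : 0 < n) (i : Fin n) :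
    finMod hn ((fpred i).val + 1) = i := by
  apply Fin.ext
  simp only [fpred, finMod, Nat.mod_add_mod]
  rw [show i.val + (n - 1) + 1 = i.val + n by omega, Nat.add_mod_right,
    Nat.mod_eq_of_lt i.isLt]

/-- The `2n` variables of a joint state, in cyclic order. -/
def cycleBit {n : ℕ} (hn : 0 < n) (k : ℕ) (s : Fin n → Bool × Bool) : Bool :=
  if k % 2 = 0 then (s (finMod hn (k / 2))).1 else (s (finMod hn (k / 2))).2

/-- The bunch and connection laws on the edges of the cycle of `2n` variables. -/
noncomputable def cycleLaw {n : ℕ} (hn : 0 < n) (b : Fin n → Bool → Bool → ℝ) (k : ℕ) :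
    Bool → Bool → ℝ :=
  if k % 2 = 0 then b (finMod hn (k / 2)) else fun r r' => mmc b (finMod hn (k / 2 + 1)) r' r

section Cycle

variable {n : ℕ} (hn : 0 < n)

lemma cycleBit_even (m : ℕ) : cycleBit hn (2 * m) = fun s => (s (finMod hn m)).1 := by
  funext s
  simp [cycleBit]

lemma cycleBit_odd (m : ℕ) : cycleBit hn (2 * m + 1) = fun s => (s (finMod hn m)).2 := by
  funext s
  simp [cycleBit, Nat.add_mod, show (2 * m + 1) / 2 = m by omega]

lemma cycleBit_closed : cycleBit hn (2 * n) = cycleBit hn 0 := by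
  rw [cycleBit_even, ← Nat.mul_zero 2, cycleBit_even, finMod_self]

variable (b : Fin n → Bool → Bool → ℝ)

lemma cycleLaw_even (m : ℕ) : cycleLaw hn b (2 * m) = b (finMod hn m) := by
  simp [cycleLaw]

lemma cycleLaw_odd (m : ℕ) :
    cycleLaw hn b (2 * m + 1) = fun r r' => mmc b (finMod hn (m + 1)) r' r := by
  simp [cycleLaw, Nat.add_mod, show (2 * m + 1) / 2 = m by omega]

lemma cycleLaw_closed : cycleLaw hn b (2 * n) = cycleLaw hn b 0 := by
  rw [cycleLaw_even, ← Nat.mul_zero 2, cycleLaw_even, finMod_self]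

lemma pairLaw_cycleBit_even (y : (Fin n → Bool × Bool) → ℝ) (m : ℕ) (r r' : Bool) :
    pairLaw y (cycleBit hn (2 * m)) (cycleBit hn (2 * m + 1)) r r' = Bm (finMod hn m) y r r' := by
  simp [pairLaw, Bm, cycleBit_even, cycleBit_odd, Prod.ext_iff]

lemma pairLaw_cycleBit_odd (y : (Fin n → Bool × Bool) → ℝ) (m : ℕ) (r r' : Bool) :
    pairLaw y (cycleBit hn (2 * m + 1)) (cycleBit hn (2 * m + 1 + 1)) r r' =
      Cm (finMod hn (m + 1)) y r' r := by
  rw [show 2 * m + 1 + 1 = 2 * (m + 1) by ring]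
  simp [pairLaw, Cm, cycleBit_even, cycleBit_odd, fpred_finMod_succ, and_comm]

lemma feasible_iff (y : (Fin n → Bool × Bool) → ℝ) :
    Feasible b y ↔
      ∀ k < 2 * n, pairLaw y (cycleBit hn k) (cycleBit hn (k + 1)) = cycleLaw hn b k := by
  constructor
  · intro h k _
    funext r r'
    obtain ⟨m, rfl | rfl⟩ := Nat.even_or_odd' k
    · rw [pairLaw_cycleBit_even, cycleLaw_even, (h _ r r').1]
    · rw [pairLaw_cycleBit_odd, cycleLaw_odd, (h _ r' r).2]
  · intro h i r r'
    constructor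
    · have := congrFun₂ (h (2 * i.val) (by omega)) r r'
      rwa [pairLaw_cycleBit_even, cycleLaw_even, finMod_val] at this
    · have := congrFun₂ (h (2 * (fpred i).val + 1) (by omega)) r' r
      rwa [pairLaw_cycleBit_odd, cycleLaw_odd, finMod_fpred_succ] at this

variable {b}

lemma mmc_marginals (hb : IsCyclicSystem n b) (i : Fin n) :
    (∀ r r', 0 ≤ mmc b i r r') ∧ (∀ r, mmc b i r false + mmc b i r true = mFst b i r) ∧
      ∀ r, mmc b i false r + mmc b i true r = mSnd b i r := by
  have h1 := hb.2 i
  have h2 := hb.2 (fpred i)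
  have h3 := hb.1 i
  have h4 := hb.1 (fpred i)
  simp only [Bool.forall_bool, Fintype.sum_bool, mmc, mFst, mSnd] at *
  refine ⟨?_, ?_⟩ <;> grind

lemma cycleLaw_nonneg (hb : IsCyclicSystem n b) (k : ℕ) (r r' : Bool) :
    0 ≤ cycleLaw hn b k r r' := by
  unfold cycleLaw
  split_ifs
  exacts [hb.1 _ _ _, (mmc_marginals hb _).1 _ _]

lemma cycleLaw_consistent (hb : IsCyclicSystem n b) (k : ℕ) (r : Bool) :
    cycleLaw hn b k false r + cycleLaw hn b k true r =
      cycleLaw hn b (k + 1) r false + cycleLaw hn b (k + 1) r true := by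
  obtain ⟨m, rfl | rfl⟩ := Nat.even_or_odd' k
  · rw [cycleLaw_odd, cycleLaw_even, (mmc_marginals hb _).2.2, mSnd, fpred_finMod_succ]
  · rw [cycleLaw_odd, show 2 * m + 1 + 1 = 2 * (m + 1) by ring, cycleLaw_even,
      (mmc_marginals hb _).2.1, mFst]

lemma cycleLaw_total (hb : IsCyclicSystem n b) (k : ℕ) :
    cycleLaw hn b k true true + cycleLaw hn b k true false + cycleLaw hn b k false true +
      cycleLaw hn b k false false = 1 := by
  have key : ∀ m, b (finMod hn m) true true + b (finMod hn m) true false +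
      b (finMod hn m) false true + b (finMod hn m) false false = 1 := fun m => by
    have := hb.2 (finMod hn m)
    simp only [Fintype.sum_bool] at this
    linarith
  obtain ⟨m, rfl | rfl⟩ := Nat.even_or_odd' k
  · rw [cycleLaw_even, key]
  · have h1 := (mmc_marginals hb (finMod hn (m + 1))).2.1 true
    have h2 := (mmc_marginals hb (finMod hn (m + 1))).2.1 false
    have h3 := key (m + 1)
    rw [cycleLaw_odd]
    simp only [mFst] at h1 h2
    linarith

/-- The cycle inequalities are sufficient for a joint law on the state space of the system. -/
lemma exists_state_law {p : ℕ → Bool → Bool → ℝ} {T : ℝ}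
    (hp : ∀ k a b, 0 ≤ p k a b)
    (hT : ∀ k, p k true true + p k true false + p k false true + p k false false = T)
    (hc : ∀ k b, p k false b + p k true b = p (k + 1) b false + p (k + 1) b true)
    (hper : p (2 * n) = p 0)
    (h : ∀ γ, Odd (trueCount γ (2 * n)) → T ≤ ∑ k ∈ range (2 * n), xorMass (p k) (γ k)) :
    ∃ z : (Fin n → Bool × Bool) → ℝ, (∀ s, 0 ≤ z s) ∧
      ∀ k < 2 * n, pairLaw z (cycleBit hn k) (cycleBit hn (k + 1)) = p k := by
  obtain ⟨Ω, _, μ, X, hμ, hX, hl⟩ := exists_cycle_law (by omega) hp hT hc hper h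
  let S : Ω → Fin n → Bool × Bool := fun ω i => (X (2 * i.val) ω, X (2 * i.val + 1) ω)
  have hS : ∀ k ≤ 2 * n, ∀ ω, cycleBit hn k (S ω) = X k ω := by
    intro k hk ω
    rcases hk.lt_or_eq with hk | rfl
    · obtain ⟨m, rfl | rfl⟩ := Nat.even_or_odd' k
      · simp [cycleBit_even, S, finMod, Nat.mod_eq_of_lt (show m < n by omega)]
      · simp [cycleBit_odd, S, finMod, Nat.mod_eq_of_lt (show m < n by omega)]
    · rw [cycleBit_closed, hX]
      simp [cycleBit, S, finMod]
  refine ⟨fun s => ∑ ω, if S ω = s then μ ω else 0,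
    fun s => Finset.sum_nonneg fun ω _ => by split_ifs <;> simp [hμ], fun k hk => ?_⟩
  rw [← hl k hk]
  funext r r'
  have : ∀ s, (if cycleBit hn k s = r ∧ cycleBit hn (k + 1) s = r' then
      ∑ ω, (if S ω = s then μ ω else 0) else 0) = ∑ ω, if S ω = s then
        (if cycleBit hn k s = r ∧ cycleBit hn (k + 1) s = r' then μ ω else 0) else 0 := by
    intro s
    split_ifs <;> simp
  simp only [pairLaw, this]
  rw [Finset.sum_comm]
  simp [hS k hk.le, hS (k + 1) hk]

end Cycle

/-- Two distinct cycle inequalities cannot both be violated: their sum always holds. -/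
lemma add_sum_xorMass_ge {p : ℕ → Bool → Bool → ℝ} (hp : ∀ k a b, 0 ≤ p k a b)
    (hT : ∀ k, p k true true + p k true false + p k false true + p k false false = 1) {N : ℕ}
    {γ γ' : ℕ → Bool} (hγ : Odd (trueCount γ N)) (hγ' : Odd (trueCount γ' N))
    (hne : ∃ k < N, γ k ≠ γ' k) :
    2 ≤ ∑ k ∈ range N, xorMass (p k) (γ k) + ∑ k ∈ range N, xorMass (p k) (γ' k) := by
  obtain ⟨m, hm⟩ := trueCount_xor γ γ' N
  have hpos : 0 < trueCount (fun k => xor (γ k) (γ' k)) N := by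
    obtain ⟨k, hk, hkne⟩ := hne
    refine Finset.sum_pos' (fun _ _ => Nat.zero_le _) ⟨k, by simpa using hk, ?_⟩
    cases h : γ k <;> cases h' : γ' k <;> simp_all
  have h2 : 2 ≤ trueCount (fun k => xor (γ k) (γ' k)) N := by grind
  calc (2 : ℝ) ≤ (trueCount (fun k => xor (γ k) (γ' k)) N : ℝ) := by exact_mod_cast h2
    _ ≤ _ := by
      rw [← Finset.sum_add_distrib, trueCount, Nat.cast_sum]
      refine Finset.sum_le_sum fun k _ => ?_
      have h := hp k
      have := hT k
      simp only [Bool.forall_bool] at h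
      cases γ k <;> cases γ' k <;> simp [xorMass] <;> linarith

/-- On an even cycle some closed bit sequence disagrees with a given odd pattern on all edges but
one. -/
lemma exists_worst_state {n : ℕ} (hn : 0 < n) {γ : ℕ → Bool} (hγ : Odd (trueCount γ (2 * n))) :
    ∃ v : Fin n → Bool × Bool,
      trueCount (fun k => xor (xor (cycleBit hn k v) (cycleBit hn (k + 1) v)) (γ k)) (2 * n) + 1
        = 2 * n := by
  let x : ℕ → Bool := fun k => decide (Odd (trueCount (fun j => !γ j) k))
  have hx : ∀ k, xor (xor (x k) (x (k + 1))) (γ k) = true := by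
    intro k
    have : trueCount (fun j => !γ j) (k + 1) = trueCount (fun j => !γ j) k + (!γ k).toNat :=
      Finset.sum_range_succ _ _
    simp only [x, this]
    cases γ k <;> by_cases h : Odd (trueCount (fun j => !γ j) k) <;> simp [h, Nat.odd_add_one]
  let v : Fin n → Bool × Bool := fun i => (x (2 * i.val), x (2 * i.val + 1))
  have hv : ∀ k < 2 * n, cycleBit hn k v = x k := by
    intro k hk
    obtain ⟨m, rfl | rfl⟩ := Nat.even_or_odd' k
    · simp [cycleBit_even, v, finMod, Nat.mod_eq_of_lt (show m < n by omega)]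
    · simp [cycleBit_odd, v, finMod, Nat.mod_eq_of_lt (show m < n by omega)]
  refine ⟨v, le_antisymm (trueCount_closed (even_two_mul n) hγ (x := fun k => cycleBit hn k v)
    (by simp only [cycleBit_closed])).2 ?_⟩
  obtain ⟨N, hN⟩ : ∃ N, 2 * n = N + 1 := ⟨2 * n - 1, by omega⟩
  rw [hN, trueCount, Finset.sum_range_succ, Finset.sum_congr rfl (g := fun _ => 1) fun k hk => by
    rw [Finset.mem_range] at hk
    rw [hv k (by omega), hv (k + 1) (by omega), hx k, Bool.toNat_true]]
  simp

/-- Lower bound on the total variation of a quasi-coupling from a cycle inequality. -/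
lemma one_add_two_mul_le_sum_abs {n : ℕ} (hn : 2 ≤ n) {b : Fin n → Bool → Bool → ℝ}
    (hb : IsCyclicSystem n b) {γ : ℕ → Bool} (hγ : Odd (trueCount γ (2 * n)))
    {y : (Fin n → Bool × Bool) → ℝ} (hy : Feasible b y) :
    1 + 2 * ((1 - ∑ k ∈ range (2 * n), xorMass (cycleLaw (by omega) b k) (γ k)) / (2 * n - 2)) ≤
      ∑ s, |y s| := by
  have h0 : 0 < n := by omega
  have hn' : (2 : ℝ) ≤ n := by exact_mod_cast hn
  have hl := (feasible_iff h0 b y).1 hy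
  have htot : ∑ s, y s = 1 := by
    have h := cycleLaw_total h0 hb 0
    rw [← hl 0 (by omega)] at h
    simp only [pairLaw, ← Finset.sum_add_distrib] at h
    rw [← h]
    refine Finset.sum_congr rfl fun s _ => ?_
    cases cycleBit h0 0 s <;> cases cycleBit h0 (0 + 1) s <;> simp
  have hsum : ∑ k ∈ range (2 * n), xorMass (cycleLaw h0 b k) (γ k) = ∑ s, y s *
      (trueCount (fun k => xor (xor (cycleBit h0 k s) (cycleBit h0 (k + 1) s)) (γ k))
        (2 * n) : ℝ) := by
    rw [← sum_xorMass_pairLaw]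
    exact Finset.sum_congr rfl fun k hk => by rw [hl k (Finset.mem_range.1 hk)]
  have hpt : ∀ s, y s * (2 * n) - 2 * (y s *
      (trueCount (fun k => xor (xor (cycleBit h0 k s) (cycleBit h0 (k + 1) s)) (γ k)) (2 * n) : ℝ))
      ≤ |y s| * (2 * n - 2) := by
    intro s
    obtain ⟨hw1, hw2⟩ := trueCount_closed (even_two_mul n) hγ (x := fun k => cycleBit h0 k s)
      (by simp only [cycleBit_closed])
    generalize trueCount _ _ = w at hw1 hw2 ⊢
    have hw1' : (1 : ℝ) ≤ w := by exact_mod_cast hw1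
    have hw2' : (w : ℝ) + 1 ≤ 2 * n := by exact_mod_cast hw2
    rcases abs_cases (y s) with ⟨h, h'⟩ | ⟨h, h'⟩ <;> rw [h] <;> nlinarith
  have := Finset.sum_le_sum fun s (_ : s ∈ univ) => hpt s
  rw [Finset.sum_sub_distrib, ← Finset.mul_sum, ← Finset.sum_mul, ← Finset.sum_mul, ← hsum,
    htot] at this
  have hpos : (0 : ℝ) < 2 * n - 2 := by linarith
  rw [← mul_div_assoc, one_add_div hpos.ne', div_le_iff₀ hpos]
  linarith

/-- If a cyclic system of rank `n ≥ 2` is contextual, there is an optimal feasible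
signed quasi-coupling with a single negative component, equal to `-CNT3(b)/2`. -/
theorem exists_optimal_single_negative (n : ℕ) (hn : 2 ≤ n)
    (b : Fin n → Bool → Bool → ℝ) (hb : IsCyclicSystem n b)
    (hctx : ¬ Noncontextual b) :
    ∃ y : (Fin n → Bool × Bool) → ℝ, Feasible b y ∧
      (∑ s, |y s|) = 1 + CNT3 b ∧
      ∃ v : Fin n → Bool × Bool, {s | y s < 0} = {v} ∧ y v = -(CNT3 b / 2) := by
  have h0 : 0 < n := by omega
  have hn' : (2 : ℝ) ≤ n := by exact_mod_cast hn
  obtain ⟨γ, hγ, hviol⟩ : ∃ γ, Odd (trueCount γ (2 * n)) ∧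
      ∑ k ∈ range (2 * n), xorMass (cycleLaw h0 b k) (γ k) < 1 := by
    by_contra! h
    obtain ⟨z, hz, hl⟩ := exists_state_law h0 (cycleLaw_nonneg h0 hb) (cycleLaw_total h0 hb)
      (cycleLaw_consistent h0 hb) (cycleLaw_closed h0 b) h
    exact hctx ⟨z, (feasible_iff h0 b z).2 hl, hz⟩
  have hlow : ∀ y, Feasible b y → _ := fun y hy => one_add_two_mul_le_sum_abs hn hb hγ hy
  obtain ⟨q, hq⟩ : ∃ q, q = (1 - ∑ k ∈ range (2 * n), xorMass (cycleLaw h0 b k) (γ k)) /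
    (2 * n - 2) := ⟨_, rfl⟩
  rw [← hq] at hlow
  have hq0 : 0 < q := hq ▸ div_pos (by linarith) (by linarith)
  have hqmul : q * (2 * n - 2) = 1 - ∑ k ∈ range (2 * n), xorMass (cycleLaw h0 b k) (γ k) := by
    rw [hq, div_mul_cancel₀ _ (by linarith : (0 : ℝ) < 2 * n - 2).ne']
  obtain ⟨v, hv⟩ := exists_worst_state h0 hγ
  let δ : (Fin n → Bool × Bool) → ℝ := Pi.single v q
  have hδ : ∀ k r r', pairLaw δ (cycleBit h0 k) (cycleBit h0 (k + 1)) r r' =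
      if cycleBit h0 k v = r ∧ cycleBit h0 (k + 1) v = r' then q else 0 := by
    intro k r r'
    rw [pairLaw, Fintype.sum_eq_single v fun s hs => by simp [δ, hs]]
    simp [δ]
  let p : ℕ → Bool → Bool → ℝ := fun k r r' =>
    cycleLaw h0 b k r r' + pairLaw δ (cycleBit h0 k) (cycleBit h0 (k + 1)) r r'
  have hpx : ∀ k g, xorMass (p k) g = xorMass (cycleLaw h0 b k) g +
      xorMass (pairLaw δ (cycleBit h0 k) (cycleBit h0 (k + 1))) g := by
    intro k g
    cases g <;> simp only [xorMass, p] <;> ring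
  obtain ⟨z, hz, hzl⟩ := exists_state_law h0 (p := p) (T := 1 + q)
    (fun k r r' => add_nonneg (cycleLaw_nonneg h0 hb k r r') (by
      rw [hδ]
      split_ifs <;> linarith))
    (fun k => by
      have := cycleLaw_total h0 hb k
      simp only [p, hδ]
      cases cycleBit h0 k v <;> cases cycleBit h0 (k + 1) v <;> simp <;> linarith)
    (fun k r => by
      have := cycleLaw_consistent h0 hb k r
      simp only [p, hδ]
      cases cycleBit h0 k v <;> cases cycleBit h0 (k + 1) v <;> cases cycleBit h0 (k + 1 + 1) v <;>
        cases r <;> simp <;> linarith)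
    (by
      funext r r'
      have h1 : cycleBit h0 (2 * n + 1) = cycleBit h0 1 := by
        rw [cycleBit_odd, show 1 = 2 * 0 + 1 from rfl, cycleBit_odd, finMod_self]
      simp only [p, cycleLaw_closed, cycleBit_closed, h1, zero_add])
    (fun γ' hγ' => by
      simp only [hpx, Finset.sum_add_distrib, sum_xorMass_pairLaw]
      rw [Fintype.sum_eq_single v fun s hs => by simp [δ, hs]]
      by_cases hne : ∃ k < 2 * n, γ k ≠ γ' k
      · have h2 := add_sum_xorMass_ge (cycleLaw_nonneg h0 hb) (cycleLaw_total h0 hb) hγ hγ' hne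
        have hw := (trueCount_closed (even_two_mul n) hγ' (x := fun k => cycleBit h0 k v)
          (by simp only [cycleBit_closed])).1
        have hw' : (1 : ℝ) ≤ (trueCount (fun k => xor (xor (cycleBit h0 k v)
          (cycleBit h0 (k + 1) v)) (γ' k)) (2 * n) : ℝ) := by exact_mod_cast hw
        have := mul_le_mul_of_nonneg_left hw' hq0.le
        simp only [δ, Pi.single_eq_same]
        nlinarith
      · push Not at hne
        have e1 : ∑ k ∈ range (2 * n), xorMass (cycleLaw h0 b k) (γ' k) =
            ∑ k ∈ range (2 * n), xorMass (cycleLaw h0 b k) (γ k) :=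
          Finset.sum_congr rfl fun k hk => by rw [hne k (Finset.mem_range.1 hk)]
        have e2 : trueCount (fun k => xor (xor (cycleBit h0 k v) (cycleBit h0 (k + 1) v)) (γ' k))
            (2 * n) = trueCount (fun k => xor (xor (cycleBit h0 k v) (cycleBit h0 (k + 1) v))
            (γ k)) (2 * n) :=
          Finset.sum_congr rfl fun k hk => by
            simp only [hne k (Finset.mem_range.1 hk)]
        have hv' : (trueCount (fun k => xor (xor (cycleBit h0 k v) (cycleBit h0 (k + 1) v))
            (γ k)) (2 * n) : ℝ) = 2 * n - 1 := by
          rw [eq_sub_iff_add_eq]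
          exact_mod_cast hv
        rw [e1, e2, hv']
        simp only [δ, Pi.single_eq_same]
        linarith)
  have hztot : ∑ s, z s = 1 + q := by
    have h : p 0 true true + p 0 true false + p 0 false true + p 0 false false = 1 + q := by
      have := cycleLaw_total h0 hb 0
      simp only [p, hδ]
      cases cycleBit h0 0 v <;> cases cycleBit h0 (0 + 1) v <;> simp <;> linarith
    rw [← hzl 0 (by omega)] at h
    simp only [pairLaw, ← Finset.sum_add_distrib] at h
    rw [← h]
    refine Finset.sum_congr rfl fun s _ => ?_
    cases cycleBit h0 0 s <;> cases cycleBit h0 (0 + 1) s <;> simp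
  have hfeas : Feasible b (z - δ) := by
    rw [feasible_iff h0]
    intro k hk
    funext r r'
    have h1 : pairLaw (z - δ) (cycleBit h0 k) (cycleBit h0 (k + 1)) r r' =
        pairLaw z (cycleBit h0 k) (cycleBit h0 (k + 1)) r r' -
          pairLaw δ (cycleBit h0 k) (cycleBit h0 (k + 1)) r r' := by
      simp only [pairLaw, ← Finset.sum_sub_distrib]
      refine Finset.sum_congr rfl fun s _ => ?_
      split_ifs <;> simp
    rw [h1, hzl k hk]
    simp [p]
  have hoff : ∀ s, s ≠ v → (z - δ) s = z s := fun s hs => by simp [δ, hs]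
  have hat : (z - δ) v = z v - q := by simp [δ]
  have habs : ∑ s, |(z - δ) s| = 1 + q - z v + |z v - q| := by
    rw [← hztot, ← Finset.add_sum_erase _ _ (mem_univ v), ← Finset.add_sum_erase _ z (mem_univ v),
      hat, Finset.sum_congr rfl fun s hs => by
        rw [hoff s (Finset.ne_of_mem_erase hs), abs_of_nonneg (hz s)]]
    ring
  have hzv : z v = 0 := by
    have h := hlow _ hfeas
    rw [habs] at h
    have := hz v
    rcases abs_cases (z v - q) with ⟨h', _⟩ | ⟨h', _⟩ <;> linarith
  have hopt : ∑ s, |(z - δ) s| = 1 + 2 * q := by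
    rw [habs, hzv, zero_sub, abs_neg, abs_of_pos hq0]
    ring
  have hcnt : CNT3 b = 2 * q := by
    have : IsLeast {t : ℝ | ∃ y, Feasible b y ∧ t = ∑ s : Fin n → Bool × Bool, |y s|}
        (1 + 2 * q) := by
      refine ⟨⟨_, hfeas, hopt.symm⟩, ?_⟩
      rintro t ⟨y, hy, rfl⟩
      exact hlow y hy
    rw [CNT3, this.csInf_eq]
    ring
  refine ⟨z - δ, hfeas, by rw [hopt, hcnt], v, ?_, by rw [hat, hzv, hcnt]; ring⟩
  ext s
  rw [Set.mem_ofPred_eq, Set.mem_singleton_iff]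
  refine ⟨fun h => ?_, fun h => ?_⟩
  · by_contra hs
    rw [hoff s hs] at h
    exact (hz s).not_gt h
  · rw [h, hat, hzv]
    linarith
end
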